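/- Let W ∈ ∂θ(P) with P ≠ 0. Then H ∈ C_θ(P,W) together with ψ*_{(P,H)}(W) = 0 holds if and only if H belongs to the polar cone (C_{θ*}(W,P))°. -/

import Mathlib

open Matrix Filter Set RealInnerProductSpace

noncomputable section

/-- Trace inner product on real matrices: `⟨A,B⟩ = trace (Aᵀ B)`. -/
def minner {ι κ : Type*} [Fintype ι] [Fintype κ] (A B : Matrix ι κ ℝ) : ℝ :=
  (Aᵀ * B).trace

/-- Frobenius norm. -/
def fnorm {ι κ : Type*} [Fintype ι] [Fintype κ] (A : Matrix ι κ ℝ) : ℝ :=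
  Real.sqrt (minner A A)

/-- Spectral norm (largest singular value), as the ℓ²-operator norm. -/
def specNorm {ι κ : Type*} [Fintype ι] [Fintype κ] (A : Matrix ι κ ℝ) : ℝ :=
  sSup {r : ℝ | ∃ x : κ → ℝ, ∑ j, x j ^ 2 = 1 ∧
    r = Real.sqrt (∑ i, (∑ j, A i j * x j) ^ 2)}

/-- Convex subdifferential with respect to the trace inner product. -/
def subdiff {ι κ : Type*} [Fintype ι] [Fintype κ] (f : Matrix ι κ ℝ → ℝ)
    (X : Matrix ι κ ℝ) : Set (Matrix ι κ ℝ) :=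
  {G | ∀ Y, f X + minner G (Y - X) ≤ f Y}

/-- One-sided directional derivative. -/
def dirDeriv {ι κ : Type*} [Fintype ι] [Fintype κ] (f : Matrix ι κ ℝ → ℝ)
    (X D : Matrix ι κ ℝ) : ℝ :=
  limUnder (nhdsWithin (0 : ℝ) (Set.Ioi 0)) fun t => (f (X + t • D) - f X) / t

/-- Critical cone of the spectral norm θ at `P` for `W`. -/
def critTheta {ι κ : Type*} [Fintype ι] [Fintype κ] (P W : Matrix ι κ ℝ) :
    Set (Matrix ι κ ℝ) :=
  {D | dirDeriv specNorm P D = minner D W}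

/-- Conjugate θ* of the spectral norm, as an extended-real-valued function
(it is the indicator of the nuclear norm unit ball). -/
def thetaStar {ι κ : Type*} [Fintype ι] [Fintype κ] (W : Matrix ι κ ℝ) : EReal :=
  ⨆ X : Matrix ι κ ℝ, ((minner W X - specNorm X : ℝ) : EReal)

/-- Lower directional epiderivative of an extended-real-valued function. -/
def epiDeriv {ι κ : Type*} [Fintype ι] [Fintype κ] (g : Matrix ι κ ℝ → EReal)
    (X D : Matrix ι κ ℝ) : EReal :=
  liminf (fun p : ℝ × Matrix ι κ ℝ =>
      (((p.1)⁻¹ : ℝ) : EReal) * (g (X + p.1 • p.2) - g X))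
    ((nhdsWithin (0 : ℝ) (Set.Ioi 0)) ×ˢ nhds D)

/-- Critical cone of θ* at `W` for `P`. -/
def critThetaStar {ι κ : Type*} [Fintype ι] [Fintype κ] (W P : Matrix ι κ ℝ) :
    Set (Matrix ι κ ℝ) :=
  {D | epiDeriv thetaStar W D = ((minner D P : ℝ) : EReal)}

/-- Second-order directional derivative. -/
def dirDeriv2 {ι κ : Type*} [Fintype ι] [Fintype κ] (f : Matrix ι κ ℝ → ℝ)
    (X D W' : Matrix ι κ ℝ) : ℝ :=
  limUnder (nhdsWithin (0 : ℝ) (Set.Ioi 0)) fun t =>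
    (f (X + t • D + (t ^ 2 / 2) • W') - f X - t * dirDeriv f X D) / (t ^ 2 / 2)

/-- The sigma term of θ: `ψ*_{(P,D)}(W) = (θ''(P;D,·))*(W)`. -/
def sigmaTheta {ι κ : Type*} [Fintype ι] [Fintype κ] (P D W : Matrix ι κ ℝ) : EReal :=
  ⨆ Z : Matrix ι κ ℝ, ((minner W Z - dirDeriv2 specNorm P D Z : ℝ) : EReal)

/-- Lower second-order directional epiderivative of an EReal-valued function. -/
def epiDeriv2 {ι κ : Type*} [Fintype ι] [Fintype κ] (g : Matrix ι κ ℝ → EReal)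
    (X D W' : Matrix ι κ ℝ) : EReal :=
  liminf (fun p : ℝ × Matrix ι κ ℝ =>
      ((2 / p.1 ^ 2 : ℝ) : EReal) *
        (g (X + p.1 • D + (p.1 ^ 2 / 2) • p.2) - g X - (p.1 : ℝ) * epiDeriv g X D))
    ((nhdsWithin (0 : ℝ) (Set.Ioi 0)) ×ˢ nhds W')

/-- The sigma term of θ*: `φ*_{(W,H)}(P) = ((θ*)''(W;H,·))*(P)`. -/
def sigmaThetaStar {ι κ : Type*} [Fintype ι] [Fintype κ] (W H P : Matrix ι κ ℝ) : EReal :=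
  ⨆ Z : Matrix ι κ ℝ, (((minner P Z : ℝ) : EReal) - epiDeriv2 thetaStar W H Z)

/-- Polar cone with respect to the trace inner product. -/
def polarCone {ι κ : Type*} [Fintype ι] [Fintype κ] (K : Set (Matrix ι κ ℝ)) :
    Set (Matrix ι κ ℝ) :=
  {H | ∀ D ∈ K, minner H D ≤ 0}

/-- Rectangular diagonal matrix `[Diag σ  0]`. -/
def diagRect {m n : ℕ} (σ : Fin m → ℝ) : Matrix (Fin m) (Fin n) ℝ :=
  Matrix.of fun i j => if (j : ℕ) = (i : ℕ) then σ i else 0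

/-- Symmetric part `S(A₁)` of the left m×m block of an m×n matrix. -/
def symLeft {m n : ℕ} (hmn : m ≤ n) (A : Matrix (Fin m) (Fin n) ℝ) :
    Matrix (Fin m) (Fin m) ℝ :=
  Matrix.of fun i j => (A i (Fin.castLE hmn j) + A j (Fin.castLE hmn i)) / 2

/-- Skew-symmetric part `T(A₁)` of the left m×m block of an m×n matrix. -/
def skewLeft {m n : ℕ} (hmn : m ≤ n) (A : Matrix (Fin m) (Fin n) ℝ) :
    Matrix (Fin m) (Fin m) ℝ :=
  Matrix.of fun i j => (A i (Fin.castLE hmn j) - A j (Fin.castLE hmn i)) / 2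

/-- Quadratic form `xᵀ A x`. -/
def quadForm {m : ℕ} (A : Matrix (Fin m) (Fin m) ℝ) (x : Fin m → ℝ) : ℝ :=
  ∑ i, ∑ j, x i * A i j * x j

/-- Proximal mapping. -/
def prox {ι κ : Type*} [Fintype ι] [Fintype κ] (f : Matrix ι κ ℝ → ℝ)
    (Z : Matrix ι κ ℝ) : Matrix ι κ ℝ :=
  Classical.epsilon fun Y =>
    ∀ X, f Y + (1 / 2) * fnorm (Y - Z) ^ 2 ≤ f X + (1 / 2) * fnorm (X - Z) ^ 2

/-- Directional derivative of the proximal mapping. -/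
def proxDeriv {ι κ : Type*} [Fintype ι] [Fintype κ] (f : Matrix ι κ ℝ → ℝ)
    (Z D : Matrix ι κ ℝ) : Matrix ι κ ℝ :=
  limUnder (nhdsWithin (0 : ℝ) (Set.Ioi 0)) fun t =>
    t⁻¹ • (prox f (Z + t • D) - prox f Z)

end

open Topology in
theorem tendsto_max_div_of_pencil {V : Type*} [NormedAddCommGroup V] [InnerProductSpace ℝ V]
    [FiniteDimensional ℝ V] (A B : V →L[ℝ] V) (g : ℝ → ℝ) (f : ℝ)
    (hA : ∀ x, ⟪A x, x⟫ ≤ 0)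
    (hB : ∀ x, ⟪A x, x⟫ = 0 → ‖x‖ = 1 → ⟪B x, x⟫ ≤ f)
    (h0 : ∃ x, ‖x‖ = 1 ∧ ⟪A x, x⟫ = 0 ∧ ⟪B x, x⟫ = f)
    (hle : ∀ t x, ‖x‖ = 1 → ⟪A x, x⟫ + t * ⟪B x, x⟫ ≤ g t)
    (hmax : ∀ t, ∃ x, ‖x‖ = 1 ∧ ⟪A x, x⟫ + t * ⟪B x, x⟫ = g t) :
    Tendsto (fun t => g t / t) (𝓝[>] 0) (𝓝 f) := by
  choose x hx hxg using hmax
  obtain ⟨y, hy, hAy, hBy⟩ := h0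
  rw [tendsto_iff_ultrafilter]
  intro U hU
  have hpos : ∀ᶠ t in (U : Filter ℝ), 0 < t := hU self_mem_nhdsWithin
  have ht : Tendsto (fun t : ℝ => t) U (𝓝 0) := hU.trans nhdsWithin_le_nhds
  obtain ⟨z, hz, hxz⟩ := (isCompact_sphere (0 : V) 1).ultrafilter_le_nhds (U.map x)
    (le_principal_iff.2 (mem_map.2 (Filter.univ_mem' fun t => by simp [hx])))
  replace hxz : Tendsto x U (𝓝 z) := hxz
  have hz1 : ‖z‖ = 1 := by simpa using hz
  have qc : ∀ T : V →L[ℝ] V, Tendsto (fun t => ⟪T (x t), x t⟫) U (𝓝 ⟪T z, z⟫) := fun T =>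
    (((by fun_prop : Continuous fun v : V => ⟪T v, v⟫).tendsto z).comp hxz)
  have hlow : ∀ᶠ t in (U : Filter ℝ), f ≤ g t / t := by
    filter_upwards [hpos] with t h
    rw [le_div_iff₀ h]
    have := hle t y hy
    rw [hAy, hBy] at this; linarith
  have hup : ∀ᶠ t in (U : Filter ℝ), g t / t ≤ ⟪B (x t), x t⟫ := by
    filter_upwards [hpos] with t h
    rw [div_le_iff₀ h, ← hxg t]
    have := hA (x t)
    linarith
  have hAz : ⟪A z, z⟫ = 0 := by
    refine le_antisymm (hA z) ?_
    have h1 : Tendsto (fun t => ⟪A (x t), x t⟫ + t * ⟪B (x t), x t⟫) U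
      (𝓝 (⟪A z, z⟫ + 0 * ⟪B z, z⟫)) := (qc A).add (ht.mul (qc B))
    have h2 : Tendsto (fun t : ℝ => f * t) U (𝓝 (f * 0)) := ht.const_mul f
    have := le_of_tendsto_of_tendsto h2 h1 (by
      filter_upwards [hlow, hpos] with t h h'
      rw [hxg]; rwa [le_div_iff₀ h'] at h)
    simpa using this
  have hBz : ⟪B z, z⟫ = f :=
    le_antisymm (hB z hAz hz1) (ge_of_tendsto (qc B) (by
      filter_upwards [hlow, hup] with t h h' using h.trans h'))
  exact tendsto_of_tendsto_of_tendsto_of_le_of_le' tendsto_const_nhds (hBz ▸ qc B) hlow hup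

/-- A negative semidefinite symmetric operator is uniformly negative transversally to its kernel. -/
theorem exists_gap_of_nonpos {V : Type*} [NormedAddCommGroup V] [InnerProductSpace ℝ V]
    [FiniteDimensional ℝ V] (A : V →L[ℝ] V) (hAs : ∀ x y, ⟪A x, y⟫ = ⟪x, A y⟫)
    (hA : ∀ x, ⟪A x, x⟫ ≤ 0) :
    ∃ α > 0, ∀ x, ∃ y z, x = y + z ∧ A y = 0 ∧ ⟪y, z⟫ = 0 ∧ ⟪A z, z⟫ ≤ -(α * ‖z‖ ^ 2) := by
  have hker : ∀ x, ⟪A x, x⟫ = 0 → A x = 0 := by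
    intro x hx
    have key : ∀ s : ℝ, 0 ≤ (-⟪A (A x), A x⟫) * (s * s) + (-2 * ⟪A x, A x⟫) * s + 0 := by
      intro s
      have := hA (x + s • A x)
      simp only [map_add, map_smul, inner_add_left, inner_add_right, inner_smul_left,
        inner_smul_right, hAs (A x) x, hx] at this
      simp only [conj_trivial] at this
      linarith
    have := discrim_le_zero key
    simp only [discrim] at this
    have : ⟪A x, A x⟫ = 0 := by nlinarith [sq_nonneg ⟪A x, A x⟫]
    simpa using this
  set K : Submodule ℝ V := LinearMap.ker (A : V →ₗ[ℝ] V) with hK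
  have hcomp : IsCompact (Metric.sphere (0 : V) 1 ∩ (Kᗮ : Set V)) :=
    (isCompact_sphere 0 1).inter_right K.isClosed_orthogonal
  obtain ⟨α, hα, hgap⟩ : ∃ α > 0, ∀ z ∈ Metric.sphere (0 : V) 1 ∩ (Kᗮ : Set V),
      ⟪A z, z⟫ ≤ -α := by
    rcases (Metric.sphere (0 : V) 1 ∩ (Kᗮ : Set V)).eq_empty_or_nonempty with he | hne
    · exact ⟨1, one_pos, by simp [he]⟩
    · obtain ⟨z, hz, hmax⟩ := hcomp.exists_isMaxOn hne
        (by fun_prop : Continuous fun v : V => ⟪A v, v⟫).continuousOn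
      refine ⟨-⟪A z, z⟫, ?_, fun w hw => by simpa using hmax hw⟩
      have h1 : ⟪A z, z⟫ ≠ 0 := by
        intro h
        have hzK : z ∈ K := by simpa [hK] using hker z h
        have : ⟪z, z⟫ = 0 := hz.2 z hzK
        have h2 : z = 0 := by simpa using this
        have := hz.1
        simp [h2] at this
      have := lt_of_le_of_ne (hA z) h1
      linarith
  refine ⟨α, hα, fun x => ⟨K.starProjection x, x - K.starProjection x, by simp, ?_, ?_, ?_⟩⟩
  · have : K.starProjection x ∈ K := Submodule.starProjection_apply_mem K x
    exact LinearMap.mem_ker.1 this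
  · exact K.sub_starProjection_mem_orthogonal x _ (Submodule.starProjection_apply_mem K x)
  · set z := x - K.starProjection x with hz
    have hzK : z ∈ Kᗮ := K.sub_starProjection_mem_orthogonal x
    by_cases h0 : z = 0
    · simp [h0]
    · have hn : ‖z‖ ≠ 0 := by simpa using h0
      have := hgap (‖z‖⁻¹ • z) ⟨by simp [norm_smul, hn], Kᗮ.smul_mem _ hzK⟩
      simp only [map_smul, inner_smul_left, inner_smul_right] at this
      simp only [conj_trivial] at this
      have h2 : ⟪A z, z⟫ = ‖z‖ ^ 2 * (‖z‖⁻¹ * (‖z‖⁻¹ * ⟪A z, z⟫)) := by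
        field_simp
      rw [h2]
      nlinarith [sq_nonneg ‖z‖]

open Topology in
theorem exists_tendsto_max_div_sq_of_pencil {V : Type*} [NormedAddCommGroup V]
    [InnerProductSpace ℝ V] [FiniteDimensional ℝ V] (A B C : V →L[ℝ] V) (g : ℝ → ℝ)
    (hAs : ∀ x y, ⟪A x, y⟫ = ⟪x, A y⟫) (hBs : ∀ x y, ⟪B x, y⟫ = ⟪x, B y⟫)
    (hA : ∀ x, ⟪A x, x⟫ ≤ 0)
    (hB : ∀ x, ⟪A x, x⟫ = 0 → ⟪B x, x⟫ ≤ 0)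
    (h0 : ∃ x, ‖x‖ = 1 ∧ ⟪A x, x⟫ = 0 ∧ ⟪B x, x⟫ = 0)
    (hle : ∀ t x, ⟪A x, x⟫ + t * ⟪B x, x⟫ + t ^ 2 / 2 * ⟪C x, x⟫ ≤ g t * ‖x‖ ^ 2)
    (hmax : ∀ t, ∃ x, ‖x‖ = 1 ∧
      ⟪A x, x⟫ + t * ⟪B x, x⟫ + t ^ 2 / 2 * ⟪C x, x⟫ = g t) :
    ∃ L, Tendsto (fun t => g t / (t ^ 2 / 2)) (𝓝[>] 0) (𝓝 L) := by
  choose x hx hxg using hmax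
  obtain ⟨y₀, hy₀, hAy₀, hBy₀⟩ := h0
  obtain ⟨α, hα, hgap⟩ := exists_gap_of_nonpos A hAs hA
  choose y z hxyz hAy hyz hz using fun t => hgap (x t)
  set β := ‖B‖
  set γ := ‖C‖
  have hβ : 0 ≤ β := norm_nonneg _
  have hγ : 0 ≤ γ := norm_nonneg _
  have bound : ∀ (T : V →L[ℝ] V) (v w : V), |⟪T v, w⟫| ≤ ‖T‖ * ‖v‖ * ‖w‖ := fun T v w =>
    (abs_real_inner_le_norm _ _).trans
      (mul_le_mul_of_nonneg_right (T.le_opNorm v) (norm_nonneg w))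
  have hpyth : ∀ t, ‖y t‖ ^ 2 + ‖z t‖ ^ 2 = 1 := by
    intro t
    have := norm_add_sq_real (y t) (z t)
    rw [← hxyz, hx, hyz] at this
    linarith
  have hy1 : ∀ t, ‖y t‖ ≤ 1 := fun t => by nlinarith [hpyth t, norm_nonneg (y t)]
  have hz1 : ∀ t, ‖z t‖ ≤ 1 := fun t => by nlinarith [hpyth t, norm_nonneg (z t)]
  have hAx : ∀ t, ⟪A (x t), x t⟫ = ⟪A (z t), z t⟫ := by
    intro t
    rw [hxyz, map_add, hAy, zero_add, inner_add_right, hAs, hAs, real_inner_comm, ← hAs, hAy]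
    simp
  have hBx : ∀ t, ⟪B (x t), x t⟫ = ⟪B (y t), y t⟫ + 2 * ⟪B (y t), z t⟫ + ⟪B (z t), z t⟫ := by
    intro t
    have : ⟪B (z t), y t⟫ = ⟪B (y t), z t⟫ := by rw [hBs, real_inner_comm]
    rw [hxyz, map_add, inner_add_right, inner_add_left, inner_add_left, this]
    ring
  have hByn : ∀ t, ⟪B (y t), y t⟫ ≤ 0 := fun t => hB _ (by simp [hAy])
  have hBest : ∀ t, 2 * ⟪B (y t), z t⟫ + ⟪B (z t), z t⟫ ≤ 3 * β * ‖z t‖ := by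
    intro t
    have h1 := (le_abs_self _).trans (bound B (y t) (z t))
    have h2 := (le_abs_self _).trans (bound B (z t) (z t))
    have h3 : β * ‖y t‖ * ‖z t‖ ≤ β * 1 * ‖z t‖ := by gcongr; exact hy1 t
    have h4 : β * ‖z t‖ * ‖z t‖ ≤ β * 1 * ‖z t‖ := by gcongr; exact hz1 t
    linarith
  have hCx : ∀ t, |⟪C (x t), x t⟫| ≤ γ := fun t => by simpa [hx] using bound C (x t) (x t)
  have hlow : ∀ t, -(γ * (t ^ 2 / 2)) ≤ g t := by
    intro t
    have h1 := hle t y₀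
    have h2 := bound C y₀ y₀
    rw [hy₀] at h1 h2
    rw [hAy₀, hBy₀] at h1
    have h3 := (abs_le.1 h2).1
    nlinarith [sq_nonneg t]
  have hup : ∀ t, 0 < t → g t ≤ -(α * ‖z t‖ ^ 2) + t * (3 * β * ‖z t‖) + γ * (t ^ 2 / 2) := by
    intro t ht
    rw [← hxg t, hAx, hBx]
    have h1 := (abs_le.1 (hCx t)).2
    have h2 := mul_le_mul_of_nonneg_left (add_le_add (hByn t) (hBest t)) ht.le
    have h3 := mul_le_mul_of_nonneg_left h1 (by positivity : 0 ≤ t ^ 2 / 2)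
    linarith [hz t]
  set R := (3 * β + γ) / α + 1 with hR
  have hw : ∀ t, 0 < t → ‖t⁻¹ • z t‖ ≤ R := by
    intro t ht
    rw [norm_smul, norm_inv, Real.norm_of_nonneg ht.le, inv_mul_le_iff₀ ht]
    by_contra! hcon
    have h1 := (hlow t).trans (hup t ht)
    have h2 : ‖z t‖ * (α * ‖z t‖) ≤ ‖z t‖ * (t * (3 * β)) + γ * t ^ 2 := by nlinarith
    have h3 : t * (3 * β + γ) + t * α < α * ‖z t‖ := by
      have : α * (t * R) = t * (3 * β + γ) + t * α := by rw [hR]; field_simp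
      rw [← this]; gcongr
    have h4 : t ≤ ‖z t‖ := by
      have : 1 ≤ R := by rw [hR]; have : 0 ≤ (3 * β + γ) / α := by positivity
                         linarith
      nlinarith
    nlinarith [mul_pos ht ht, mul_pos ht hα, mul_nonneg hγ ht.le,
      mul_le_mul_of_nonneg_left h4 (mul_nonneg hγ ht.le)]
  -- every limit along an ultrafilter is a value of the same variational problem
  have hcluster : ∀ U : Ultrafilter ℝ, (U : Filter ℝ) ≤ 𝓝[>] 0 →
      ∃ L, Tendsto (fun t => g t / (t ^ 2 / 2)) U (𝓝 L) ∧ ∃ y w, ‖y‖ = 1 ∧ A y = 0 ∧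
        ⟪B y, y⟫ = 0 ∧ L ≤ 2 * (⟪A w, w⟫ + 2 * ⟪B y, w⟫) + ⟪C y, y⟫ := by
    intro U hU
    have hpos : ∀ᶠ t in (U : Filter ℝ), 0 < t := hU self_mem_nhdsWithin
    have ht : Tendsto (fun t : ℝ => t) U (𝓝 0) := hU.trans nhdsWithin_le_nhds
    obtain ⟨ys, -, hys⟩ := (isCompact_closedBall (0 : V) 1).ultrafilter_le_nhds (U.map y)
      (le_principal_iff.2 (mem_map.2 (Filter.univ_mem' fun t => by simp [hy1])))
    replace hys : Tendsto y U (𝓝 ys) := hys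
    obtain ⟨ws, -, hws⟩ := (isCompact_closedBall (0 : V) R).ultrafilter_le_nhds
      (U.map fun t => t⁻¹ • z t) (by
        rw [Ultrafilter.coe_map, le_principal_iff, mem_map]
        filter_upwards [hpos] with t h
        simpa using hw t h)
    replace hws : Tendsto (fun t => t⁻¹ • z t) U (𝓝 ws) := hws
    have hbd : ∀ᶠ t in (U : Filter ℝ), g t / (t ^ 2 / 2) ∈ Set.Icc (-γ) (9 * β ^ 2 / (2 * α) + γ) := by
      filter_upwards [hpos] with t h
      constructor
      · rw [le_div_iff₀ (by positivity)]; linarith [hlow t]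
      · rw [div_le_iff₀ (by positivity)]
        have h1 : -(α * ‖z t‖ ^ 2) + t * (3 * β * ‖z t‖) ≤ 9 * β ^ 2 / (2 * α) * (t ^ 2 / 2) := by
          rw [← sub_nonneg]
          have : 9 * β ^ 2 / (2 * α) * (t ^ 2 / 2) - (-(α * ‖z t‖ ^ 2) + t * (3 * β * ‖z t‖)) =
            (3 * β * t - 2 * α * ‖z t‖) ^ 2 / (4 * α) := by field_simp; ring
          rw [this]; positivity
        linarith [hup t h]
    obtain ⟨L, -, hL⟩ := isCompact_Icc.ultrafilter_le_nhds
      (U.map fun t => g t / (t ^ 2 / 2)) (by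
        rw [Ultrafilter.coe_map, le_principal_iff]; exact hbd)
    replace hL : Tendsto (fun t => g t / (t ^ 2 / 2)) U (𝓝 L) := hL
    have hzt : ∀ᶠ t in (U : Filter ℝ), z t = t • (t⁻¹ • z t) := by
      filter_upwards [hpos] with t h
      rw [smul_smul, mul_inv_cancel₀ h.ne', one_smul]
    have hxs : Tendsto x U (𝓝 ys) := by
      have h1 : Tendsto (fun t => y t + t • (t⁻¹ • z t)) U (𝓝 (ys + (0 : ℝ) • ws)) :=
        hys.add (ht.smul hws)
      rw [zero_smul, add_zero] at h1
      refine h1.congr' ?_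
      filter_upwards [hzt] with t h
      rw [← h, ← hxyz]
    have hys1 : ‖ys‖ = 1 := tendsto_nhds_unique hxs.norm (by simp [hx])
    have hAys : A ys = 0 :=
      tendsto_nhds_unique ((A.continuous.tendsto ys).comp hys) (by
        simp only [Function.comp_def, hAy]; exact tendsto_const_nhds)
    have qc : ∀ (T : V →L[ℝ] V) {p q : ℝ → V} {p' q' : V}, Tendsto p U (𝓝 p') →
        Tendsto q U (𝓝 q') → Tendsto (fun t => ⟪T (p t), q t⟫) U (𝓝 ⟪T p', q'⟫) :=
      fun T p q p' q' hp hq => ((T.continuous.tendsto p').comp hp).inner hq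
    set Φ : ℝ → ℝ := fun t => 2 * (⟪A (t⁻¹ • z t), t⁻¹ • z t⟫ + 2 * ⟪B (y t), t⁻¹ • z t⟫
      + t * ⟪B (t⁻¹ • z t), t⁻¹ • z t⟫) + ⟪C (x t), x t⟫ with hΦ
    have hΦlim : Tendsto Φ U (𝓝 (2 * (⟪A ws, ws⟫ + 2 * ⟪B ys, ws⟫ + 0 * ⟪B ws, ws⟫)
        + ⟪C ys, ys⟫)) :=
      ((((qc A hws hws).add ((qc B hys hws).const_mul 2)).add
        (ht.mul (qc B hws hws))).const_mul 2).add (qc C hxs hxs)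
    have hexp : ∀ᶠ t in (U : Filter ℝ),
        g t = ⟪B (y t), y t⟫ * t + t ^ 2 / 2 * Φ t := by
      filter_upwards [hpos] with t h
      rw [← hxg t, hAx, hBx]
      simp only [hΦ, map_smul, inner_smul_left, inner_smul_right, conj_trivial]
      field_simp
      ring
    refine ⟨L, hL, ys, ws, hys1, hAys, ?_, ?_⟩
    · refine le_antisymm (hB _ (by simp [hAys])) ?_
      have h1 : Tendsto (fun t => ⟪B (y t), y t⟫ + t / 2 * Φ t + γ * (t / 2)) U
          (𝓝 (⟪B ys, ys⟫ + 0 / 2 * _ + γ * (0 / 2))) :=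
        ((qc B hys hys).add ((ht.div_const 2).mul hΦlim)).add
          ((ht.div_const 2).const_mul γ)
      have := ge_of_tendsto h1 (b := 0) (by
        filter_upwards [hexp, hpos] with t h h'
        have h2 := hlow t
        rw [h] at h2
        have : 0 ≤ t * (⟪B (y t), y t⟫ + t / 2 * Φ t + γ * (t / 2)) := by linarith
        exact nonneg_of_mul_nonneg_right this h')
      simpa using this
    · rw [zero_mul, add_zero] at hΦlim
      refine le_of_tendsto_of_tendsto hL hΦlim ?_
      filter_upwards [hexp, hpos] with t h h'
      rw [div_le_iff₀ (by positivity), h]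
      nlinarith [hByn t]
  have hlower : ∀ y w, ‖y‖ = 1 → A y = 0 → ⟪B y, y⟫ = 0 → ∀ (U : Ultrafilter ℝ) (L : ℝ),
      (U : Filter ℝ) ≤ 𝓝[>] 0 → Tendsto (fun t => g t / (t ^ 2 / 2)) U (𝓝 L) →
      2 * (⟪A w, w⟫ + 2 * ⟪B y, w⟫) + ⟪C y, y⟫ ≤ L := by
    intro y w hy hAy hBy U L hU hL
    have hpos : ∀ᶠ t in (U : Filter ℝ), 0 < t := hU self_mem_nhdsWithin
    have ht : Tendsto (fun t : ℝ => t) U (𝓝 0) := hU.trans nhdsWithin_le_nhds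
    have h1 : Tendsto (fun t : ℝ => 2 * (⟪A w, w⟫ + 2 * ⟪B y, w⟫ + t * ⟪B w, w⟫)
        + ⟪C (y + t • w), y + t • w⟫) U (𝓝 (2 * (⟪A w, w⟫ + 2 * ⟪B y, w⟫ + 0 * ⟪B w, w⟫)
        + ⟪C (y + (0 : ℝ) • w), y + (0 : ℝ) • w⟫)) :=
      ((by fun_prop : Continuous fun t : ℝ => 2 * (⟪A w, w⟫ + 2 * ⟪B y, w⟫ + t * ⟪B w, w⟫)
        + ⟪C (y + t • w), y + t • w⟫).tendsto 0).comp ht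
    have h2 : Tendsto (fun t : ℝ => g t / (t ^ 2 / 2) * ‖y + t • w‖ ^ 2) U
        (𝓝 (L * ‖y + (0 : ℝ) • w‖ ^ 2)) :=
      hL.mul (((by fun_prop : Continuous fun t : ℝ => ‖y + t • w‖ ^ 2).tendsto 0).comp ht)
    have := le_of_tendsto_of_tendsto h1 h2 (by
      filter_upwards [hpos] with t h
      have h3 := hle t (y + t • w)
      have e1 : ⟪A (y + t • w), y + t • w⟫ = t ^ 2 * ⟪A w, w⟫ := by
        rw [hAs, map_add, hAy, zero_add, inner_add_left, map_smul, inner_smul_right,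
          ← hAs y, hAy, inner_smul_left, inner_smul_right, ← hAs]
        simp; ring
      have e2 : ⟪B (y + t • w), y + t • w⟫ = 2 * t * ⟪B y, w⟫ + t ^ 2 * ⟪B w, w⟫ := by
        have : ⟪B w, y⟫ = ⟪B y, w⟫ := by rw [hBs, real_inner_comm]
        simp only [map_add, map_smul, inner_add_left, inner_add_right, inner_smul_left,
          inner_smul_right, hBy, this, conj_trivial]
        ring
      rw [e1, e2] at h3
      rw [div_mul_eq_mul_div, le_div_iff₀ (by positivity)]
      linarith)
    simpa [hy] using this
  obtain ⟨L, hL, y₁, w₁, e₁, e₂, e₃, hLle⟩ := hcluster (Ultrafilter.of (𝓝[>] 0)) (Ultrafilter.of_le _)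
  refine ⟨L, (tendsto_iff_ultrafilter _ _ _).2 fun U hU => ?_⟩
  obtain ⟨L', hL', y₂, w₂, e₁', e₂', e₃', hLle'⟩ := hcluster U hU
  have h1 := hLle.trans (hlower y₁ w₁ e₁ e₂ e₃ U L' hU hL')
  have h2 := hLle'.trans (hlower y₂ w₂ e₁' e₂' e₃' _ L (Ultrafilter.of_le _) hL)
  rwa [le_antisymm h1 h2]

section TraceInnerProduct

variable {ι κ : Type*} [Fintype ι] [Fintype κ]

theorem minner_eq_sum (A B : Matrix ι κ ℝ) : minner A B = ∑ j, ∑ i, A i j * B i j := by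
  simp [minner, Matrix.trace, Matrix.mul_apply]

theorem minner_comm (A B : Matrix ι κ ℝ) : minner A B = minner B A := by
  simp [minner_eq_sum, mul_comm]

theorem minner_add_right (A B C : Matrix ι κ ℝ) : minner A (B + C) = minner A B + minner A C := by
  simp [minner, Matrix.mul_add]

theorem minner_add_left (A B C : Matrix ι κ ℝ) : minner (A + B) C = minner A C + minner B C := by
  simp [minner, Matrix.add_mul]

theorem minner_sub_right (A B C : Matrix ι κ ℝ) : minner A (B - C) = minner A B - minner A C := by
  simp [minner, Matrix.mul_sub]

theorem minner_sub_left (A B C : Matrix ι κ ℝ) : minner (A - B) C = minner A C - minner B C := by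
  simp [minner, Matrix.sub_mul]

theorem minner_smul_right (c : ℝ) (A B : Matrix ι κ ℝ) : minner A (c • B) = c * minner A B := by
  simp [minner]

theorem minner_smul_left (c : ℝ) (A B : Matrix ι κ ℝ) : minner (c • A) B = c * minner A B := by
  simp [minner]

theorem minner_sum_left {τ : Type*} [Fintype τ] (F : τ → Matrix ι κ ℝ) (B : Matrix ι κ ℝ) :
    minner (∑ i, F i) B = ∑ i, minner (F i) B := by
  simp [minner, Matrix.transpose_sum, Matrix.sum_mul, Matrix.trace_sum]

theorem minner_vecMulVec (u : ι → ℝ) (v : κ → ℝ) (Z : Matrix ι κ ℝ) :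
    minner (vecMulVec u v) Z = u ⬝ᵥ Z *ᵥ v := by
  simp only [minner_eq_sum, vecMulVec_apply, dotProduct, mulVec, Finset.mul_sum]
  rw [Finset.sum_comm]
  exact Finset.sum_congr rfl fun i _ => Finset.sum_congr rfl fun j _ => by ring

theorem continuous_minner_left (A : Matrix ι κ ℝ) : Continuous fun B => minner A B := by
  simp only [minner]
  fun_prop

end TraceInnerProduct

section SpectralNorm

variable {ι κ : Type*} [Fintype ι] [Fintype κ]

theorem exists_isMax_dotProduct_mulVec_self [Nonempty κ] (A : Matrix ι κ ℝ) :
    ∃ v : κ → ℝ, v ⬝ᵥ v = 1 ∧ specNorm A = √((A *ᵥ v) ⬝ᵥ (A *ᵥ v)) ∧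
      ∀ x : κ → ℝ, x ⬝ᵥ x = 1 → (A *ᵥ x) ⬝ᵥ (A *ᵥ x) ≤ (A *ᵥ v) ⬝ᵥ (A *ᵥ v) := by
  classical
  have hS : IsCompact {x : κ → ℝ | x ⬝ᵥ x = 1} := by
    refine Metric.isCompact_of_isClosed_isBounded
      (isClosed_eq (by fun_prop) continuous_const) ?_
    refine (Metric.isBounded_closedBall (x := (0 : κ → ℝ)) (r := 1)).subset fun x hx => ?_
    rw [mem_closedBall_zero_iff, pi_norm_le_iff_of_nonneg zero_le_one]
    intro j
    have h1 : x j * x j ≤ x ⬝ᵥ x :=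
      Finset.single_le_sum (f := fun j => x j * x j) (fun i _ => mul_self_nonneg _)
        (Finset.mem_univ j)
    have hx' : x ⬝ᵥ x = 1 := hx
    rw [Real.norm_eq_abs, abs_le_one_iff_mul_self_le_one]
    linarith
  obtain ⟨j₀⟩ := ‹Nonempty κ›
  have hne : {x : κ → ℝ | x ⬝ᵥ x = 1}.Nonempty := ⟨Pi.single j₀ 1, by simp⟩
  obtain ⟨v, hv, hmax⟩ := hS.exists_isMaxOn hne
    (by fun_prop : Continuous fun x : κ → ℝ => (A *ᵥ x) ⬝ᵥ (A *ᵥ x)).continuousOn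
  refine ⟨v, hv, ?_, fun x hx => hmax hx⟩
  have hset : {r : ℝ | ∃ x : κ → ℝ, ∑ j, x j ^ 2 = 1 ∧
      r = Real.sqrt (∑ i, (∑ j, A i j * x j) ^ 2)} =
      (fun x => √((A *ᵥ x) ⬝ᵥ (A *ᵥ x))) '' {x : κ → ℝ | x ⬝ᵥ x = 1} := by
    ext r
    simp only [Set.mem_image, Set.mem_ofPred_eq, dotProduct, mulVec, ← pow_two, eq_comm (a := r)]
  rw [specNorm, hset]
  refine IsGreatest.csSup_eq ⟨⟨v, hv, rfl⟩, ?_⟩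
  rintro _ ⟨x, hx, rfl⟩
  exact Real.sqrt_le_sqrt (hmax hx)

theorem specNorm_nonneg (A : Matrix ι κ ℝ) : 0 ≤ specNorm A :=
  Real.sSup_nonneg (by rintro _ ⟨x, -, rfl⟩; exact Real.sqrt_nonneg _)

theorem dotProduct_self_nonneg' (x : ι → ℝ) : 0 ≤ x ⬝ᵥ x :=
  Finset.sum_nonneg fun _ _ => mul_self_nonneg _

theorem mulVec_dotProduct_self_le [Nonempty κ] (A : Matrix ι κ ℝ) (x : κ → ℝ) :
    (A *ᵥ x) ⬝ᵥ (A *ᵥ x) ≤ specNorm A ^ 2 * (x ⬝ᵥ x) := by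
  obtain ⟨v, hv, hA, hmax⟩ := exists_isMax_dotProduct_mulVec_self A
  rw [hA, Real.sq_sqrt (dotProduct_self_nonneg' _)]
  by_cases h0 : x ⬝ᵥ x = 0
  · simp [dotProduct_self_eq_zero.1 h0]
  have hpos : 0 < x ⬝ᵥ x := lt_of_le_of_ne (dotProduct_self_nonneg' x) (Ne.symm h0)
  have hs : √(x ⬝ᵥ x) * √(x ⬝ᵥ x) = x ⬝ᵥ x := Real.mul_self_sqrt hpos.le
  have hs0 : √(x ⬝ᵥ x) ≠ 0 := (Real.sqrt_pos.2 hpos).ne'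
  have := hmax ((√(x ⬝ᵥ x))⁻¹ • x) (by
    rw [smul_dotProduct, dotProduct_smul, smul_eq_mul, smul_eq_mul]
    field_simp
    rw [pow_two, hs])
  rw [mulVec_smul, smul_dotProduct, dotProduct_smul, smul_eq_mul, smul_eq_mul, ← mul_assoc,
    ← mul_inv, hs, inv_mul_le_iff₀ hpos] at this
  linarith

theorem specNorm_le_of_forall [Nonempty κ] (A : Matrix ι κ ℝ) {r : ℝ} (hr : 0 ≤ r)
    (h : ∀ x, (A *ᵥ x) ⬝ᵥ (A *ᵥ x) ≤ r ^ 2 * (x ⬝ᵥ x)) : specNorm A ≤ r := by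
  obtain ⟨v, hv, hA, -⟩ := exists_isMax_dotProduct_mulVec_self A
  rw [hA, Real.sqrt_le_left hr]
  simpa [hv] using h v

theorem two_mul_dotProduct_mulVec_le [Nonempty κ] (A : Matrix ι κ ℝ) (u : ι → ℝ) (v : κ → ℝ) :
    2 * (u ⬝ᵥ A *ᵥ v) ≤ specNorm A * (u ⬝ᵥ u + v ⬝ᵥ v) := by
  have h1 := mulVec_dotProduct_self_le A v
  have h2 := dotProduct_self_nonneg' (specNorm A • u - A *ᵥ v)
  have h3 := specNorm_nonneg A
  simp only [sub_dotProduct, dotProduct_sub, smul_dotProduct, dotProduct_smul, smul_eq_mul,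
    dotProduct_comm (A *ᵥ v) u] at h2
  rcases h3.eq_or_lt with h | h
  · rw [← h] at h1 ⊢
    have : A *ᵥ v = 0 := dotProduct_self_eq_zero.1
      (le_antisymm (by simpa using h1) (dotProduct_self_nonneg' _))
    simp [this]
  · refine le_of_mul_le_mul_left ?_ h
    nlinarith

/-- The spectral norm is attained by the quadratic form `2 uᵀ A v`. -/
theorem exists_two_mul_dotProduct_mulVec_eq [Nonempty κ] (A : Matrix ι κ ℝ) :
    ∃ (u : ι → ℝ) (v : κ → ℝ), u ⬝ᵥ u + v ⬝ᵥ v = 1 ∧ 2 * (u ⬝ᵥ A *ᵥ v) = specNorm A := by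
  obtain ⟨v, hv, hA, -⟩ := exists_isMax_dotProduct_mulVec_self A
  have hsq : specNorm A ^ 2 = (A *ᵥ v) ⬝ᵥ (A *ᵥ v) := by
    rw [hA, Real.sq_sqrt (dotProduct_self_nonneg' _)]
  rcases (specNorm_nonneg A).eq_or_lt with h | h
  · exact ⟨0, v, by simp [hv], by simp [← h]⟩
  · have h2 : √2 * √2 = (2 : ℝ) := Real.mul_self_sqrt (by norm_num)
    have h20 : √2 ≠ (0 : ℝ) := by positivity
    refine ⟨(√2 * specNorm A)⁻¹ • A *ᵥ v, (√2)⁻¹ • v, ?_, ?_⟩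
    · simp only [smul_dotProduct, dotProduct_smul, smul_eq_mul, ← hsq, hv]
      field_simp
      linarith
    · simp only [mulVec_smul, smul_dotProduct, dotProduct_smul, smul_eq_mul, ← hsq]
      field_simp
      linarith

theorem specNorm_add_le [Nonempty κ] (A B : Matrix ι κ ℝ) :
    specNorm (A + B) ≤ specNorm A + specNorm B := by
  obtain ⟨u, v, huv, h⟩ := exists_two_mul_dotProduct_mulVec_eq (A + B)
  have h1 := two_mul_dotProduct_mulVec_le A u v
  have h2 := two_mul_dotProduct_mulVec_le B u v
  rw [huv] at h1 h2
  rw [← h, add_mulVec, dotProduct_add]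
  linarith

theorem specNorm_smul_le [Nonempty κ] {c : ℝ} (hc : 0 ≤ c) (A : Matrix ι κ ℝ) :
    specNorm (c • A) ≤ c * specNorm A := by
  obtain ⟨u, v, huv, h⟩ := exists_two_mul_dotProduct_mulVec_eq (c • A)
  have h1 := two_mul_dotProduct_mulVec_le A u v
  rw [huv] at h1
  rw [← h, smul_mulVec, dotProduct_smul, smul_eq_mul]
  nlinarith

theorem specNorm_zero [Nonempty κ] : specNorm (0 : Matrix ι κ ℝ) = 0 :=
  le_antisymm (specNorm_le_of_forall _ le_rfl (by simp)) (specNorm_nonneg _)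

theorem specNorm_pos [Nonempty κ] {A : Matrix ι κ ℝ} (hA : A ≠ 0) : 0 < specNorm A := by
  classical
  refine lt_of_le_of_ne (specNorm_nonneg A) fun h => hA ?_
  ext i j
  have h1 := mulVec_dotProduct_self_le A (Pi.single j 1)
  rw [← h] at h1
  have h2 : A *ᵥ Pi.single j 1 = 0 := dotProduct_self_eq_zero.1
    (le_antisymm (by simpa using h1) (dotProduct_self_nonneg' _))
  simpa using congrFun h2 i

/-- The feasible set of `thetaStar`: matrices dominated by the spectral norm. -/
def IsDualFeasible (X : Matrix ι κ ℝ) : Prop := ∀ Z, minner X Z ≤ specNorm Z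

theorem isDualFeasible_of_mem_subdiff [Nonempty κ] {P W : Matrix ι κ ℝ}
    (hW : W ∈ subdiff specNorm P) : IsDualFeasible W := by
  intro Z
  have h := hW (P + Z)
  have := specNorm_add_le P Z
  rw [add_sub_cancel_left] at h
  linarith

theorem minner_eq_specNorm_of_mem_subdiff [Nonempty κ] {P W : Matrix ι κ ℝ}
    (hW : W ∈ subdiff specNorm P) : minner W P = specNorm P := by
  refine le_antisymm (isDualFeasible_of_mem_subdiff hW P) ?_
  have h := hW 0
  rw [specNorm_zero, minner_sub_right, show minner W 0 = 0 by simp [minner]] at h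
  linarith

theorem thetaStar_eq_zero [Nonempty κ] {X : Matrix ι κ ℝ} (hX : IsDualFeasible X) :
    thetaStar X = 0 := by
  refine le_antisymm (iSup_le fun Z => ?_) ?_
  · exact_mod_cast sub_nonpos.2 (hX Z)
  · refine le_iSup_of_le 0 ?_
    simp [specNorm_zero, minner]

theorem thetaStar_eq_top [Nonempty κ] {X : Matrix ι κ ℝ} (hX : ¬ IsDualFeasible X) :
    thetaStar X = ⊤ := by
  obtain ⟨Z, hZ⟩ := not_forall.1 hX
  push Not at hZ
  refine EReal.eq_top_iff_forall_lt _ |>.2 fun y => ?_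
  set d := minner X Z - specNorm Z with hd
  have hd0 : 0 < d := sub_pos.2 hZ
  set c := (|y| + 1) / d with hc
  have hc0 : 0 ≤ c := by positivity
  refine lt_of_lt_of_le ?_ (le_iSup _ (c • Z))
  have h1 := specNorm_smul_le hc0 Z
  have h2 : c * d = |y| + 1 := by rw [hc]; field_simp
  have h3 := le_abs_self y
  rw [minner_smul_right]
  norm_cast
  nlinarith

end SpectralNorm

section CriticalConeConjugate

variable {ι κ : Type*} [Fintype ι] [Fintype κ] [Nonempty κ]

open Topology

theorem thetaStar_nonneg (X : Matrix ι κ ℝ) : 0 ≤ thetaStar X := by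
  by_cases h : IsDualFeasible X
  · rw [thetaStar_eq_zero h]
  · rw [thetaStar_eq_top h]; exact le_top

theorem epiDeriv_thetaStar_nonneg {W : Matrix ι κ ℝ} (hW : IsDualFeasible W)
    (D : Matrix ι κ ℝ) : 0 ≤ epiDeriv thetaStar W D := by
  refine le_liminf_of_le (by isBoundedDefault) ?_
  have h : ∀ᶠ p : ℝ × Matrix ι κ ℝ in 𝓝[>] (0 : ℝ) ×ˢ 𝓝 D, 0 < p.1 :=
    tendsto_fst.eventually self_mem_nhdsWithin
  filter_upwards [h] with p hp
  rw [thetaStar_eq_zero hW, sub_zero]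
  exact mul_nonneg (by exact_mod_cast (inv_pos.2 hp).le) (thetaStar_nonneg _)

theorem epiDeriv_thetaStar_eq_zero {W D : Matrix ι κ ℝ} (hW : IsDualFeasible W)
    (h : ∃ᶠ p : ℝ × Matrix ι κ ℝ in 𝓝[>] (0 : ℝ) ×ˢ 𝓝 D, IsDualFeasible (W + p.1 • p.2)) :
    epiDeriv thetaStar W D = 0 := by
  refine le_antisymm (liminf_le_of_frequently_le ?_ (by isBoundedDefault))
    (epiDeriv_thetaStar_nonneg hW D)
  refine h.mono fun p hp => ?_
  rw [thetaStar_eq_zero hW, thetaStar_eq_zero hp]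
  simp

theorem mem_critThetaStar_of_tendsto {W P D : Matrix ι κ ℝ} (hW : IsDualFeasible W)
    (hDP : minner D P = 0) (d : ℝ → Matrix ι κ ℝ) (hd : Tendsto d (𝓝[>] 0) (𝓝 D))
    (hf : ∀ᶠ t in 𝓝[>] 0, IsDualFeasible (W + t • d t)) : D ∈ critThetaStar W P := by
  have h1 : Tendsto (fun t => (t, d t)) (𝓝[>] 0) (𝓝[>] (0 : ℝ) ×ˢ 𝓝 D) := tendsto_id.prodMk hd
  change epiDeriv thetaStar W D = ((minner D P : ℝ) : EReal)
  rw [epiDeriv_thetaStar_eq_zero hW (h1.frequently hf.frequently), hDP]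
  simp

theorem frequently_isDualFeasible {W P D : Matrix ι κ ℝ} (hW : IsDualFeasible W)
    (hD : D ∈ critThetaStar W P) :
    ∃ᶠ p : ℝ × Matrix ι κ ℝ in 𝓝[>] (0 : ℝ) ×ˢ 𝓝 D, IsDualFeasible (W + p.1 • p.2) := by
  by_contra hcon
  rw [not_frequently] at hcon
  have hpos : ∀ᶠ p : ℝ × Matrix ι κ ℝ in 𝓝[>] (0 : ℝ) ×ˢ 𝓝 D, 0 < p.1 :=
    tendsto_fst.eventually self_mem_nhdsWithin
  have htop : epiDeriv thetaStar W D = ⊤ := by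
    refine (liminf_congr (v := fun _ => ⊤) ?_).trans (liminf_const ⊤)
    filter_upwards [hcon, hpos] with p hp hp0
    rw [thetaStar_eq_zero hW, sub_zero, thetaStar_eq_top hp]
    exact EReal.coe_mul_top_of_pos (inv_pos.2 hp0)
  have : epiDeriv thetaStar W D = ((minner D P : ℝ) : EReal) := hD
  rw [htop] at this
  exact EReal.coe_ne_top _ this.symm

theorem minner_eq_zero_of_mem_critThetaStar {W P D : Matrix ι κ ℝ} (hW : IsDualFeasible W)
    (hD : D ∈ critThetaStar W P) : minner D P = 0 := by
  have : epiDeriv thetaStar W D = ((minner D P : ℝ) : EReal) := hD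
  rw [epiDeriv_thetaStar_eq_zero hW (frequently_isDualFeasible hW hD)] at this
  exact_mod_cast this.symm

theorem minner_nonpos_of_mem_critThetaStar {W P D Y : Matrix ι κ ℝ} (hW : IsDualFeasible W)
    (hD : D ∈ critThetaStar W P) (hY : specNorm Y ≤ minner W Y) : minner Y D ≤ 0 := by
  by_contra! hcon
  have hev : ∀ᶠ p : ℝ × Matrix ι κ ℝ in 𝓝[>] (0 : ℝ) ×ˢ 𝓝 D, 0 < minner Y p.2 :=
    tendsto_snd.eventually
      (((continuous_minner_left Y).tendsto D).eventually (lt_mem_nhds hcon))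
  have hpos : ∀ᶠ p : ℝ × Matrix ι κ ℝ in 𝓝[>] (0 : ℝ) ×ˢ 𝓝 D, 0 < p.1 :=
    tendsto_fst.eventually self_mem_nhdsWithin
  obtain ⟨p, hp, hp1, hp2⟩ :=
    ((frequently_isDualFeasible hW hD).and_eventually (hev.and hpos)).exists
  have := hp Y
  rw [minner_add_left, minner_smul_left, minner_comm p.2] at this
  nlinarith [mul_pos hp2 hp1]

end CriticalConeConjugate

section DirectionalDerivatives

open Topology

/-- The vector of Euclidean space with the given two blocks. -/
def blockVec {ι κ : Type*} (u : ι → ℝ) (v : κ → ℝ) : EuclideanSpace ℝ (ι ⊕ κ) :=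
  WithLp.toLp 2 (Sum.elim u v)

theorem exists_eq_blockVec {ι κ : Type*} (x : EuclideanSpace ℝ (ι ⊕ κ)) :
    ∃ u v, x = blockVec u v :=
  ⟨fun i => x (Sum.inl i), fun j => x (Sum.inr j), by
    ext k; cases k <;> rfl⟩

variable {ι κ : Type*} [Fintype ι] [Fintype κ]

open scoped Classical in
/-- The self-adjoint dilation of a rectangular matrix, as an operator on Euclidean space. -/
noncomputable def dilation (M : Matrix ι κ ℝ) :
    EuclideanSpace ℝ (ι ⊕ κ) →L[ℝ] EuclideanSpace ℝ (ι ⊕ κ) :=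
  toEuclideanCLM (𝕜 := ℝ) (fromBlocks 0 M Mᵀ 0)

theorem norm_blockVec_sq (u : ι → ℝ) (v : κ → ℝ) :
    ‖blockVec u v‖ ^ 2 = u ⬝ᵥ u + v ⬝ᵥ v := by
  rw [EuclideanSpace.real_norm_sq_eq]
  simp [blockVec, dotProduct, pow_two]

theorem norm_blockVec_eq_one_iff (u : ι → ℝ) (v : κ → ℝ) :
    ‖blockVec u v‖ = 1 ↔ u ⬝ᵥ u + v ⬝ᵥ v = 1 := by
  rw [← norm_blockVec_sq]
  exact (pow_eq_one_iff_of_nonneg (norm_nonneg _) two_ne_zero).symm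

theorem inner_dilation (M : Matrix ι κ ℝ) (x y : EuclideanSpace ℝ (ι ⊕ κ)) :
    ⟪dilation M x, y⟫ = ⟪x, dilation M y⟫ := by
  classical
  rw [real_inner_comm]
  simp only [dilation, inner_toEuclideanCLM]
  obtain ⟨u, v, rfl⟩ := exists_eq_blockVec x
  obtain ⟨u', v', rfl⟩ := exists_eq_blockVec y
  simp only [blockVec, fromBlocks_mulVec, sumElim_dotProduct_sumElim]
  simp [dotProduct_mulVec, vecMul_transpose, dotProduct_comm]
  ring

theorem inner_dilation_blockVec (M : Matrix ι κ ℝ) (u : ι → ℝ) (v : κ → ℝ) :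
    ⟪dilation M (blockVec u v), blockVec u v⟫ = 2 * (u ⬝ᵥ M *ᵥ v) := by
  classical
  rw [real_inner_comm]
  simp only [dilation, inner_toEuclideanCLM]
  simp only [blockVec, fromBlocks_mulVec, sumElim_dotProduct_sumElim]
  simp [dotProduct_mulVec, vecMul_transpose, dotProduct_comm]
  ring

theorem inner_dilation_sub_blockVec (M : Matrix ι κ ℝ) (c : ℝ) (u : ι → ℝ) (v : κ → ℝ) :
    ⟪(dilation M - c • ContinuousLinearMap.id ℝ (EuclideanSpace ℝ (ι ⊕ κ))) (blockVec u v),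
      blockVec u v⟫ = 2 * (u ⬝ᵥ M *ᵥ v) - c * (u ⬝ᵥ u + v ⬝ᵥ v) := by
  simp only [_root_.sub_apply, _root_.smul_apply, ContinuousLinearMap.id_apply, inner_sub_left,
    inner_smul_left, inner_dilation_blockVec, real_inner_self_eq_norm_sq, norm_blockVec_sq,
    conj_trivial]

/-- The pairs `(u, v)` at which the quadratic form `2 uᵀ P v` attains the spectral norm. -/
def IsTopPair (P : Matrix ι κ ℝ) (u : ι → ℝ) (v : κ → ℝ) : Prop :=
  2 * (u ⬝ᵥ P *ᵥ v) = specNorm P * (u ⬝ᵥ u + v ⬝ᵥ v)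

variable [Nonempty κ]

theorem exists_max_on_topPair (P H : Matrix ι κ ℝ) :
    ∃ f : ℝ, (∀ u v, IsTopPair P u v → 2 * (u ⬝ᵥ H *ᵥ v) ≤ f * (u ⬝ᵥ u + v ⬝ᵥ v)) ∧
      ∃ u v, u ⬝ᵥ u + v ⬝ᵥ v = 1 ∧ IsTopPair P u v ∧ 2 * (u ⬝ᵥ H *ᵥ v) = f := by
  set S : Set (EuclideanSpace ℝ (ι ⊕ κ)) :=
    Metric.sphere 0 1 ∩ {x | ⟪dilation P x, x⟫ = specNorm P} with hS
  have hcomp : IsCompact S := (isCompact_sphere 0 1).inter_right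
    (isClosed_eq (by fun_prop) continuous_const)
  have hmem : ∀ u v, blockVec u v ∈ S ↔ u ⬝ᵥ u + v ⬝ᵥ v = 1 ∧ 2 * (u ⬝ᵥ P *ᵥ v) = specNorm P := by
    intro u v
    simp [hS, norm_blockVec_eq_one_iff, inner_dilation_blockVec]
  obtain ⟨u₀, v₀, h₀, h₁⟩ := exists_two_mul_dotProduct_mulVec_eq P
  obtain ⟨x, hx, hmax⟩ := hcomp.exists_isMaxOn ⟨_, (hmem u₀ v₀).2 ⟨h₀, h₁⟩⟩
    (by fun_prop : Continuous fun x => ⟪dilation H x, x⟫).continuousOn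
  obtain ⟨u, v, rfl⟩ := exists_eq_blockVec x
  obtain ⟨e₁, e₂⟩ := (hmem u v).1 hx
  refine ⟨2 * (u ⬝ᵥ H *ᵥ v), fun u' v' h' => ?_, u, v, e₁, by rw [IsTopPair, e₁, e₂, mul_one], rfl⟩
  rcases (add_nonneg (dotProduct_self_nonneg' u') (dotProduct_self_nonneg' v')).eq_or_lt with h | h
  · have : u' = 0 := dotProduct_self_eq_zero.1 (by
      linarith [dotProduct_self_nonneg' u', dotProduct_self_nonneg' v'])
    rw [← h, this]; simp
  · set s := √(u' ⬝ᵥ u' + v' ⬝ᵥ v') with hs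
    have hss : s * s = u' ⬝ᵥ u' + v' ⬝ᵥ v' := Real.mul_self_sqrt h.le
    have hs0 : s ≠ 0 := (Real.sqrt_pos.2 h).ne'
    have hT : 2 * (u' ⬝ᵥ P *ᵥ v') = specNorm P * (u' ⬝ᵥ u' + v' ⬝ᵥ v') := h'
    have key : ∀ q : ℝ, s⁻¹ * (s⁻¹ * q) = q / (s * s) := fun q => by field_simp
    have h1 : blockVec (s⁻¹ • u') (s⁻¹ • v') ∈ S := by
      rw [hmem]
      simp only [mulVec_smul, smul_dotProduct, dotProduct_smul, smul_eq_mul, key, hss]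
      rw [← add_div, div_self h.ne', ← mul_div_assoc, hT, mul_div_cancel_right₀ _ h.ne']
      exact ⟨rfl, rfl⟩
    have h2 : ⟪dilation H (blockVec (s⁻¹ • u') (s⁻¹ • v')), blockVec (s⁻¹ • u') (s⁻¹ • v')⟫ ≤
      ⟪dilation H (blockVec u v), blockVec u v⟫ := hmax h1
    simp only [inner_dilation_blockVec, mulVec_smul, smul_dotProduct, dotProduct_smul, smul_eq_mul,
      key, hss] at h2
    rwa [← mul_div_assoc, div_le_iff₀ h] at h2

theorem tendsto_dirDeriv_specNorm (P H : Matrix ι κ ℝ) (f : ℝ)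
    (hf : ∀ u v, IsTopPair P u v → 2 * (u ⬝ᵥ H *ᵥ v) ≤ f * (u ⬝ᵥ u + v ⬝ᵥ v))
    (hf' : ∃ u v, u ⬝ᵥ u + v ⬝ᵥ v = 1 ∧ IsTopPair P u v ∧ 2 * (u ⬝ᵥ H *ᵥ v) = f) :
    dirDeriv specNorm P H = f := by
  refine Tendsto.limUnder_eq ?_
  refine tendsto_max_div_of_pencil
    (dilation P - specNorm P • ContinuousLinearMap.id ℝ (EuclideanSpace ℝ (ι ⊕ κ)))
    (dilation H) (fun t => specNorm (P + t • H) - specNorm P) f ?_ ?_ ?_ ?_ ?_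
  · intro x
    obtain ⟨u, v, rfl⟩ := exists_eq_blockVec x
    have := two_mul_dotProduct_mulVec_le P u v
    simp only [inner_dilation_sub_blockVec, inner_dilation_blockVec, norm_blockVec_sq,
      norm_blockVec_eq_one_iff]
    linarith
  · intro x
    obtain ⟨u, v, rfl⟩ := exists_eq_blockVec x
    simp only [inner_dilation_sub_blockVec, inner_dilation_blockVec, norm_blockVec_sq,
      norm_blockVec_eq_one_iff]
    intro h1 h2
    have := hf u v (sub_eq_zero.1 h1)
    rwa [h2, mul_one] at this
  · obtain ⟨u, v, h1, h2, h3⟩ := hf'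
    refine ⟨blockVec u v, ?_⟩
    simp only [inner_dilation_sub_blockVec, inner_dilation_blockVec, norm_blockVec_sq,
      norm_blockVec_eq_one_iff]
    exact ⟨h1, sub_eq_zero.2 h2, h3⟩
  · intro t x
    obtain ⟨u, v, rfl⟩ := exists_eq_blockVec x
    have := two_mul_dotProduct_mulVec_le (P + t • H) u v
    simp only [inner_dilation_sub_blockVec, inner_dilation_blockVec, norm_blockVec_sq,
      norm_blockVec_eq_one_iff]
    intro h1
    rw [h1] at this ⊢
    rw [add_mulVec, smul_mulVec, dotProduct_add, dotProduct_smul, smul_eq_mul] at this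
    linarith
  · intro t
    obtain ⟨u, v, h1, h2⟩ := exists_two_mul_dotProduct_mulVec_eq (P + t • H)
    refine ⟨blockVec u v, ?_⟩
    simp only [inner_dilation_sub_blockVec, inner_dilation_blockVec, norm_blockVec_sq,
      norm_blockVec_eq_one_iff]
    rw [add_mulVec, smul_mulVec, dotProduct_add, dotProduct_smul, smul_eq_mul] at h2
    refine ⟨h1, ?_⟩
    rw [h1]
    linarith

/-- The spectral norm is second-order directionally differentiable. -/
theorem tendsto_dirDeriv2_specNorm (P H Z : Matrix ι κ ℝ) :
    Tendsto (fun t : ℝ => (specNorm (P + t • H + (t ^ 2 / 2) • Z) - specNorm P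
      - t * dirDeriv specNorm P H) / (t ^ 2 / 2)) (𝓝[>] 0) (𝓝 (dirDeriv2 specNorm P H Z)) := by
  obtain ⟨f, hf, hf'⟩ := exists_max_on_topPair P H
  have hdf := tendsto_dirDeriv_specNorm P H f hf hf'
  refine tendsto_nhds_limUnder ?_
  rw [hdf]
  have expand : ∀ (t : ℝ) (u : ι → ℝ) (v : κ → ℝ),
      2 * (u ⬝ᵥ (P + t • H + (t ^ 2 / 2) • Z) *ᵥ v) = 2 * (u ⬝ᵥ P *ᵥ v) + t * (2 * (u ⬝ᵥ H *ᵥ v))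
        + t ^ 2 / 2 * (2 * (u ⬝ᵥ Z *ᵥ v)) := by
    intro t u v
    simp only [add_mulVec, smul_mulVec, dotProduct_add, dotProduct_smul, smul_eq_mul]
    ring
  refine exists_tendsto_max_div_sq_of_pencil
    (dilation P - specNorm P • ContinuousLinearMap.id ℝ (EuclideanSpace ℝ (ι ⊕ κ)))
    (dilation H - f • ContinuousLinearMap.id ℝ (EuclideanSpace ℝ (ι ⊕ κ))) (dilation Z)
    (fun t => specNorm (P + t • H + (t ^ 2 / 2) • Z) - specNorm P - t * f) ?_ ?_ ?_ ?_ ?_ ?_ ?_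
  · intro x y
    simp [inner_sub_left, inner_sub_right, inner_smul_left, inner_smul_right, inner_dilation]
  · intro x y
    simp [inner_sub_left, inner_sub_right, inner_smul_left, inner_smul_right, inner_dilation]
  · intro x
    obtain ⟨u, v, rfl⟩ := exists_eq_blockVec x
    have := two_mul_dotProduct_mulVec_le P u v
    simp only [inner_dilation_sub_blockVec, inner_dilation_blockVec, norm_blockVec_sq,
      norm_blockVec_eq_one_iff]
    linarith
  · intro x
    obtain ⟨u, v, rfl⟩ := exists_eq_blockVec x
    simp only [inner_dilation_sub_blockVec, inner_dilation_blockVec, norm_blockVec_sq,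
      norm_blockVec_eq_one_iff]
    intro h1
    exact sub_nonpos.2 (hf u v (sub_eq_zero.1 h1))
  · obtain ⟨u, v, h1, h2, h3⟩ := hf'
    refine ⟨blockVec u v, ?_⟩
    simp only [inner_dilation_sub_blockVec, inner_dilation_blockVec, norm_blockVec_sq,
      norm_blockVec_eq_one_iff]
    exact ⟨h1, sub_eq_zero.2 h2, by rw [h3, h1]; ring⟩
  · intro t x
    obtain ⟨u, v, rfl⟩ := exists_eq_blockVec x
    have := two_mul_dotProduct_mulVec_le (P + t • H + (t ^ 2 / 2) • Z) u v
    simp only [inner_dilation_sub_blockVec, inner_dilation_blockVec, norm_blockVec_sq,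
      norm_blockVec_eq_one_iff]
    rw [expand] at this
    linarith
  · intro t
    obtain ⟨u, v, h1, h2⟩ := exists_two_mul_dotProduct_mulVec_eq (P + t • H + (t ^ 2 / 2) • Z)
    refine ⟨blockVec u v, ?_⟩
    simp only [inner_dilation_sub_blockVec, inner_dilation_blockVec, norm_blockVec_sq,
      norm_blockVec_eq_one_iff]
    refine ⟨h1, ?_⟩
    rw [← h2, h1, expand]
    ring

end DirectionalDerivatives

universe u

section SingularVectors

variable {ι κ : Type*} [Fintype ι] [Fintype κ]

theorem exists_orthonormal_mulVec_orthogonal [DecidableEq κ] (A : Matrix ι κ ℝ) :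
    ∃ e : κ → κ → ℝ, (∀ i j, e i ⬝ᵥ e j = if i = j then 1 else 0) ∧
      (∀ i j, i ≠ j → (A *ᵥ e i) ⬝ᵥ (A *ᵥ e j) = 0) ∧
      A = ∑ j, vecMulVec (A *ᵥ e j) (e j) := by
  have hA : (Aᵀ * A).IsHermitian := by
    simpa using isHermitian_conjTranspose_mul_self A
  have ho : ∀ i j, (hA.eigenvectorBasis i).ofLp ⬝ᵥ (hA.eigenvectorBasis j).ofLp =
      if i = j then 1 else 0 := by
    intro i j
    have := hA.eigenvectorBasis.inner_eq_ite j i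
    rw [EuclideanSpace.inner_eq_star_dotProduct] at this
    simpa [eq_comm] using this
  refine ⟨fun j => (hA.eigenvectorBasis j).ofLp, ho, fun i j hij => ?_, ?_⟩
  · have h1 := hA.mulVec_eigenvectorBasis j
    have h2 : (A *ᵥ (hA.eigenvectorBasis i).ofLp) ⬝ᵥ (A *ᵥ (hA.eigenvectorBasis j).ofLp) =
        (hA.eigenvectorBasis i).ofLp ⬝ᵥ ((Aᵀ * A) *ᵥ (hA.eigenvectorBasis j).ofLp) := by
      rw [← mulVec_mulVec, dotProduct_mulVec _ Aᵀ, vecMul_transpose]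
    simp only [h2, h1, dotProduct_smul, ho, if_neg hij, smul_zero]
  · have hU : ∑ j, vecMulVec (hA.eigenvectorBasis j).ofLp (hA.eigenvectorBasis j).ofLp = 1 := by
      have := (Matrix.mem_unitaryGroup_iff).1 hA.eigenvectorUnitary.2
      rw [← this]
      ext i k
      simp [Matrix.sum_apply, vecMulVec_apply, Matrix.mul_apply, star_apply,
        IsHermitian.eigenvectorUnitary_apply]
    calc A = A * ∑ j, vecMulVec (hA.eigenvectorBasis j).ofLp (hA.eigenvectorBasis j).ofLp := by
          rw [hU, Matrix.mul_one]
      _ = _ := by simp only [Matrix.mul_sum, mul_vecMulVec]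

theorem exists_singular_decomposition {κ : Type u} [Fintype κ] (A : Matrix ι κ ℝ) :
    ∃ (τ : Type u) (_ : Fintype τ) (_ : DecidableEq τ) (s : τ → ℝ) (u : τ → ι → ℝ) (v : τ → κ → ℝ),
      (∀ i, 0 < s i) ∧ (∀ i j, u i ⬝ᵥ u j = if i = j then 1 else 0) ∧
      (∀ i j, v i ⬝ᵥ v j = if i = j then 1 else 0) ∧
      A = ∑ i, s i • vecMulVec (u i) (v i) := by
  classical
  obtain ⟨e, he, horth, hA⟩ := exists_orthonormal_mulVec_orthogonal A
  set r : κ → ℝ := fun j => √((A *ᵥ e j) ⬝ᵥ (A *ᵥ e j)) with hr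
  have hrr : ∀ j, r j * r j = (A *ᵥ e j) ⬝ᵥ (A *ᵥ e j) :=
    fun j => Real.mul_self_sqrt (dotProduct_self_nonneg' _)
  refine ⟨{j : κ // r j ≠ 0}, inferInstance, inferInstance, fun j => r j,
    fun j => (r j)⁻¹ • A *ᵥ e j, fun j => e j,
    fun j => lt_of_le_of_ne (Real.sqrt_nonneg _) j.2.symm, ?_, ?_, ?_⟩
  · rintro ⟨i, hi⟩ ⟨j, hj⟩
    simp only [smul_dotProduct, dotProduct_smul, smul_eq_mul, Subtype.mk.injEq]
    split_ifs with h
    · subst h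
      rw [← hrr]
      field_simp
    · simp [horth i j h]
  · rintro ⟨i, hi⟩ ⟨j, hj⟩
    simp [he]
  · have h0 : ∀ j, r j = 0 → A *ᵥ e j = 0 := fun j hj =>
      dotProduct_self_eq_zero.1 (by rw [← hrr, hj, mul_zero])
    have h1 : ∀ j : {j : κ // r j ≠ 0},
        r j • vecMulVec ((r j)⁻¹ • A *ᵥ e j) (e j) = vecMulVec (A *ᵥ e j) (e j) := fun j => by
      rw [smul_vecMulVec, smul_smul, mul_inv_cancel₀ j.2, one_smul]
    simp only [h1]
    conv_lhs => rw [hA]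
    rw [← Finset.sum_subtype (Finset.univ.filter fun j => r j ≠ 0) (by simp)
      fun j => vecMulVec (A *ᵥ e j) (e j)]
    refine (Finset.sum_filter_of_ne (p := fun j => r j ≠ 0) fun j _ hj hj0 => hj ?_).symm
    rw [h0 j hj0, zero_vecMulVec]

theorem sum_smul_dotProduct_self {τ : Type*} [Fintype τ] [DecidableEq τ] {v : τ → κ → ℝ}
    (hv : ∀ i j, v i ⬝ᵥ v j = if i = j then 1 else 0) (c : τ → ℝ) :
    (∑ i, c i • v i) ⬝ᵥ (∑ i, c i • v i) = ∑ i, c i ^ 2 := by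
  simp [sum_dotProduct, dotProduct_sum, hv, pow_two]

theorem sum_sq_dotProduct_le {τ : Type*} [Fintype τ] [DecidableEq τ] {v : τ → κ → ℝ}
    (hv : ∀ i j, v i ⬝ᵥ v j = if i = j then 1 else 0) (x : κ → ℝ) :
    ∑ i, (v i ⬝ᵥ x) ^ 2 ≤ x ⬝ᵥ x := by
  have h := dotProduct_self_nonneg' (x - ∑ i, (v i ⬝ᵥ x) • v i)
  rw [sub_dotProduct, dotProduct_sub, dotProduct_sub, sum_smul_dotProduct_self hv,
    dotProduct_comm x (∑ i, _)] at h
  have h2 : (∑ i, (v i ⬝ᵥ x) • v i) ⬝ᵥ x = ∑ i, (v i ⬝ᵥ x) ^ 2 := by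
    simp [sum_dotProduct, pow_two]
  linarith

theorem sum_vecMulVec_mulVec {ι τ : Type*} [Fintype τ] (u : τ → ι → ℝ) (v : τ → κ → ℝ)
    (x : κ → ℝ) :
    (∑ i, vecMulVec (u i) (v i)) *ᵥ x = ∑ i, (v i ⬝ᵥ x) • u i := by
  simp [sum_mulVec, vecMulVec_mulVec]

theorem specNorm_sum_vecMulVec_le_one [Nonempty κ] {τ : Type*} [Fintype τ] [DecidableEq τ]
    {u : τ → ι → ℝ} {v : τ → κ → ℝ} (hu : ∀ i j, u i ⬝ᵥ u j = if i = j then 1 else 0)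
    (hv : ∀ i j, v i ⬝ᵥ v j = if i = j then 1 else 0) :
    specNorm (∑ i, vecMulVec (u i) (v i)) ≤ 1 := by
  refine specNorm_le_of_forall _ zero_le_one fun x => ?_
  rw [sum_vecMulVec_mulVec, sum_smul_dotProduct_self hu, one_pow, one_mul]
  exact sum_sq_dotProduct_le hv x

theorem mulVec_eq_specNorm_smul [Nonempty κ] {P : Matrix ι κ ℝ} {u : ι → ℝ} {v : κ → ℝ}
    (hu : u ⬝ᵥ u = 1) (hv : v ⬝ᵥ v = 1) (h : u ⬝ᵥ P *ᵥ v = specNorm P) :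
    P *ᵥ v = specNorm P • u := by
  have h1 := mulVec_dotProduct_self_le P v
  have h2 : (P *ᵥ v - specNorm P • u) ⬝ᵥ (P *ᵥ v - specNorm P • u) = 0 := by
    refine le_antisymm ?_ (dotProduct_self_nonneg' _)
    simp only [sub_dotProduct, dotProduct_sub, smul_dotProduct, dotProduct_smul, smul_eq_mul,
      dotProduct_comm (P *ᵥ v) u, hu, h]
    rw [hv] at h1
    linarith
  exact sub_eq_zero.1 (dotProduct_self_eq_zero.1 h2)

theorem transpose_mulVec_eq_specNorm_smul [Nonempty κ] {P : Matrix ι κ ℝ} {u : ι → ℝ} {v : κ → ℝ}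
    (hu : u ⬝ᵥ u = 1) (hv : v ⬝ᵥ v = 1) (h : u ⬝ᵥ P *ᵥ v = specNorm P) :
    Pᵀ *ᵥ u = specNorm P • v := by
  have h1 := mulVec_dotProduct_self_le P (Pᵀ *ᵥ u)
  have h2 : u ⬝ᵥ P *ᵥ (Pᵀ *ᵥ u) = (Pᵀ *ᵥ u) ⬝ᵥ (Pᵀ *ᵥ u) := by
    rw [dotProduct_mulVec, ← mulVec_transpose]
  have h3 : v ⬝ᵥ Pᵀ *ᵥ u = specNorm P := by
    rw [dotProduct_mulVec, vecMul_transpose, dotProduct_comm, h]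
  set z := Pᵀ *ᵥ u with hz
  have h4 := dotProduct_self_nonneg' (P *ᵥ z - (z ⬝ᵥ z) • u)
  simp only [sub_dotProduct, dotProduct_sub, smul_dotProduct, dotProduct_smul, smul_eq_mul,
    dotProduct_comm (P *ᵥ z) u, hu, h2] at h4
  have h5 : z ⬝ᵥ z ≤ specNorm P ^ 2 := by
    rcases (dotProduct_self_nonneg' z).eq_or_lt with h0 | h0
    · rw [← h0]; positivity
    · refine le_of_mul_le_mul_right ?_ h0
      linarith
  have h6 : (z - specNorm P • v) ⬝ᵥ (z - specNorm P • v) = 0 := by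
    refine le_antisymm ?_ (dotProduct_self_nonneg' _)
    simp only [sub_dotProduct, dotProduct_sub, smul_dotProduct, dotProduct_smul, smul_eq_mul,
      dotProduct_comm z v, hv, h3]
    linarith
  exact sub_eq_zero.1 (dotProduct_self_eq_zero.1 h6)

/-- `W = ∑ wᵢ uᵢ vᵢᵀ` is a convex combination of unit rank-one matrices, with orthonormal
`uᵢ` and `vᵢ` built from singular vectors of `P` for its largest singular value. -/
structure IsTopFactorization {τ : Type*} [Fintype τ] [DecidableEq τ] (P W : Matrix ι κ ℝ)
    (w : τ → ℝ) (u : τ → ι → ℝ) (v : τ → κ → ℝ) : Prop where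
  pos : ∀ i, 0 < w i
  sum_eq_one : ∑ i, w i = 1
  left_orth : ∀ i j, u i ⬝ᵥ u j = if i = j then 1 else 0
  right_orth : ∀ i j, v i ⬝ᵥ v j = if i = j then 1 else 0
  eq_sum : W = ∑ i, w i • vecMulVec (u i) (v i)
  mulVec_eq : ∀ i, P *ᵥ v i = specNorm P • u i
  transpose_mulVec_eq : ∀ i, Pᵀ *ᵥ u i = specNorm P • v i

theorem IsTopFactorization.minner_eq {τ : Type*} [Fintype τ] [DecidableEq τ] {P W : Matrix ι κ ℝ}
    {w : τ → ℝ} {u : τ → ι → ℝ} {v : τ → κ → ℝ} (F : IsTopFactorization P W w u v)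
    (Z : Matrix ι κ ℝ) : minner W Z = ∑ i, w i * (u i ⬝ᵥ Z *ᵥ v i) := by
  rw [F.eq_sum, minner_sum_left]
  simp only [minner_smul_left, minner_vecMulVec]

theorem dotProduct_mulVec_le_specNorm [Nonempty κ] (Z : Matrix ι κ ℝ) {u : ι → ℝ} {v : κ → ℝ}
    (hu : u ⬝ᵥ u = 1) (hv : v ⬝ᵥ v = 1) : u ⬝ᵥ Z *ᵥ v ≤ specNorm Z := by
  have := two_mul_dotProduct_mulVec_le Z u v
  rw [hu, hv] at this
  linarith

theorem exists_isTopFactorization {κ : Type u} [Fintype κ] [Nonempty κ] {P W : Matrix ι κ ℝ}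
    (hP : 0 < specNorm P) (hW : IsDualFeasible W) (hWP : minner W P = specNorm P) :
    ∃ (τ : Type u) (_ : Fintype τ) (_ : DecidableEq τ) (w : τ → ℝ) (u : τ → ι → ℝ) (v : τ → κ → ℝ),
      IsTopFactorization P W w u v := by
  obtain ⟨τ, hτ, hd, s, u, v, hs, hu, hv, hsum⟩ := exists_singular_decomposition W
  refine ⟨τ, hτ, hd, s, u, v, ?_⟩
  have hu1 : ∀ i, u i ⬝ᵥ u i = 1 := fun i => by simp [hu]
  have hv1 : ∀ i, v i ⬝ᵥ v i = 1 := fun i => by simp [hv]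
  have hin : ∀ Z, minner W Z = ∑ i, s i * (u i ⬝ᵥ Z *ᵥ v i) := by
    intro Z
    rw [hsum, minner_sum_left]
    simp only [minner_smul_left, minner_vecMulVec]
  have hle : ∑ i, s i ≤ 1 := by
    have h := (hW _).trans (specNorm_sum_vecMulVec_le_one hu hv)
    rw [hin] at h
    simpa [sum_vecMulVec_mulVec, hv, hu] using h
  have hdef : ∀ i, 0 ≤ s i * (specNorm P - u i ⬝ᵥ P *ᵥ v i) := fun i =>
    mul_nonneg (hs i).le (sub_nonneg.2 (dotProduct_mulVec_le_specNorm P (hu1 i) (hv1 i)))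
  have htot : ∑ i, s i * (specNorm P - u i ⬝ᵥ P *ᵥ v i) = (∑ i, s i - 1) * specNorm P := by
    simp only [mul_sub, Finset.sum_sub_distrib, ← hin, hWP, ← Finset.sum_mul]
    ring
  have hone : ∑ i, s i = 1 := by
    have := Finset.sum_nonneg fun i (_ : i ∈ Finset.univ) => hdef i
    rw [htot] at this
    have := nonneg_of_mul_nonneg_left this hP
    linarith
  have htop : ∀ i, u i ⬝ᵥ P *ᵥ v i = specNorm P := by
    intro i
    rw [hone, sub_self, zero_mul, Finset.sum_eq_zero_iff_of_nonneg fun i _ => hdef i] at htot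
    have := (mul_eq_zero.1 (htot i (Finset.mem_univ i))).resolve_left (hs i).ne'
    linarith
  exact ⟨hs, hone, hu, hv, hsum, fun i => mulVec_eq_specNorm_smul (hu1 i) (hv1 i) (htop i),
    fun i => transpose_mulVec_eq_specNorm_smul (hu1 i) (hv1 i) (htop i)⟩

end SingularVectors

section NullDirections

open Topology

variable {ι κ τ : Type*} [Fintype ι] [Fintype κ] [Fintype τ] [DecidableEq τ]
  {P W K H : Matrix ι κ ℝ} {w : τ → ℝ} {u : τ → ι → ℝ} {v : τ → κ → ℝ}

theorem dotProduct_mulVec_eq_transpose (M : Matrix ι κ ℝ) (x : ι → ℝ) (y : κ → ℝ) :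
    x ⬝ᵥ M *ᵥ y = (Mᵀ *ᵥ x) ⬝ᵥ y := by
  rw [dotProduct_mulVec, mulVec_transpose]

theorem mulVec_eq_smul_of_tangent (M : Matrix ι κ ℝ) {x : ι → ℝ} {y : κ → ℝ} (hx : x ⬝ᵥ x = 1)
    (hy : y ⬝ᵥ y = 1)
    (h : ∀ a b, a ⬝ᵥ x + b ⬝ᵥ y = 0 → a ⬝ᵥ M *ᵥ y + x ⬝ᵥ M *ᵥ b ≤ 0) :
    M *ᵥ y = (x ⬝ᵥ M *ᵥ y) • x ∧ Mᵀ *ᵥ x = (x ⬝ᵥ M *ᵥ y) • y := by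
  set α := x ⬝ᵥ M *ᵥ y with hα
  have hα' : (Mᵀ *ᵥ x) ⬝ᵥ y = α := (dotProduct_mulVec_eq_transpose M x y).symm
  set a := M *ᵥ y - α • x with ha
  set b := Mᵀ *ᵥ x - α • y with hb
  have hax : a ⬝ᵥ x = 0 := by
    simp [ha, sub_dotProduct, hx, dotProduct_comm (M *ᵥ y) x, ← hα]
  have hby : b ⬝ᵥ y = 0 := by
    simp [hb, sub_dotProduct, hy, hα']
  have haa : a ⬝ᵥ M *ᵥ y = a ⬝ᵥ a := by
    conv_rhs => rw [ha, dotProduct_sub, dotProduct_smul, ← ha, hax]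
    simp
  have hbb : x ⬝ᵥ M *ᵥ b = b ⬝ᵥ b := by
    rw [dotProduct_mulVec_eq_transpose, dotProduct_comm]
    conv_rhs => rw [hb, dotProduct_sub, dotProduct_smul, ← hb, hby]
    simp
  have := h a b (by rw [hax, hby, add_zero])
  rw [haa, hbb] at this
  have h1 := dotProduct_self_nonneg' a
  have h2 := dotProduct_self_nonneg' b
  exact ⟨sub_eq_zero.1 (dotProduct_self_eq_zero.1 (by linarith : a ⬝ᵥ a = 0)),
    sub_eq_zero.1 (dotProduct_self_eq_zero.1 (by linarith : b ⬝ᵥ b = 0))⟩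

theorem IsTopFactorization.left_self (F : IsTopFactorization P W w u v) (i : τ) :
    u i ⬝ᵥ u i = 1 := by
  simp [F.left_orth]

theorem IsTopFactorization.right_self (F : IsTopFactorization P W w u v) (i : τ) :
    v i ⬝ᵥ v i = 1 := by
  simp [F.right_orth]

theorem IsTopFactorization.dotProduct_mulVec (F : IsTopFactorization P W w u v) (i : τ) :
    u i ⬝ᵥ P *ᵥ v i = specNorm P := by
  rw [F.mulVec_eq, dotProduct_smul, F.left_self, smul_eq_mul, mul_one]

theorem IsTopFactorization.isTopPair (F : IsTopFactorization P W w u v) (i : τ) :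
    IsTopPair P (u i) (v i) := by
  rw [IsTopPair, F.dotProduct_mulVec, F.left_self, F.right_self]
  ring

theorem IsTopFactorization.tangent_eq_zero (F : IsTopFactorization P W w u v) (i : τ)
    {a : ι → ℝ} {b : κ → ℝ} (hab : a ⬝ᵥ u i + b ⬝ᵥ v i = 0) :
    a ⬝ᵥ P *ᵥ v i + u i ⬝ᵥ P *ᵥ b = 0 := by
  rw [F.mulVec_eq, dotProduct_mulVec_eq_transpose, F.transpose_mulVec_eq, dotProduct_smul,
    smul_dotProduct, dotProduct_comm (v i), ← smul_add, hab, smul_zero]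

/-- Directions annihilating all the given singular vectors and nonpositive on the leading singular
pairs of `P`. -/
structure IsNullDirection (P K : Matrix ι κ ℝ) (u : τ → ι → ℝ) (v : τ → κ → ℝ) : Prop where
  mulVec_eq : ∀ i, K *ᵥ v i = 0
  transpose_mulVec_eq : ∀ i, Kᵀ *ᵥ u i = 0
  nonpos : ∀ x y, IsTopPair P x y → x ⬝ᵥ K *ᵥ y ≤ 0

theorem IsTopFactorization.isNullDirection (F : IsTopFactorization P W w u v)
    (hKW : minner W K = 0) (htop : ∀ x y, IsTopPair P x y → x ⬝ᵥ K *ᵥ y ≤ 0)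
    (htan : ∀ i a b, a ⬝ᵥ u i + b ⬝ᵥ v i = 0 → a ⬝ᵥ K *ᵥ v i + u i ⬝ᵥ K *ᵥ b ≤ 0) :
    IsNullDirection P K u v := by
  have hα : ∀ i, u i ⬝ᵥ K *ᵥ v i = 0 := by
    intro i
    rw [F.minner_eq, Finset.sum_eq_zero_iff_of_nonpos
      fun i _ => mul_nonpos_of_nonneg_of_nonpos (F.pos i).le (htop _ _ (F.isTopPair i))] at hKW
    exact (mul_eq_zero.1 (hKW i (Finset.mem_univ i))).resolve_left (F.pos i).ne'
  have h := fun i => mulVec_eq_smul_of_tangent K (F.left_self i) (F.right_self i) (htan i)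
  simp only [hα, zero_smul] at h
  exact ⟨fun i => (h i).1, fun i => (h i).2, htop⟩

/-- Difference quotient of the curve obtained from `W` by moving its `i`-th rank-one term along
the direction `(a, b)`. -/
noncomputable def rankOneQuotient (ω : ℝ) (x : ι → ℝ) (y : κ → ℝ) (a : ι → ℝ) (b : κ → ℝ) (t : ℝ) :
    Matrix ι κ ℝ :=
  (ω * (1 + t ^ 2 * ((a ⬝ᵥ a + b ⬝ᵥ b) / 2))⁻¹) •
    (vecMulVec a y + vecMulVec x b + t • vecMulVec a b -
      (t * ((a ⬝ᵥ a + b ⬝ᵥ b) / 2)) • vecMulVec x y)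

theorem minner_rankOneQuotient (ω : ℝ) (x : ι → ℝ) (y : κ → ℝ) (a : ι → ℝ) (b : κ → ℝ) (t : ℝ)
    (Z : Matrix ι κ ℝ) :
    minner (rankOneQuotient ω x y a b t) Z =
      ω * (1 + t ^ 2 * ((a ⬝ᵥ a + b ⬝ᵥ b) / 2))⁻¹ *
      (a ⬝ᵥ Z *ᵥ y + x ⬝ᵥ Z *ᵥ b + t * (a ⬝ᵥ Z *ᵥ b) -
        t * ((a ⬝ᵥ a + b ⬝ᵥ b) / 2) * (x ⬝ᵥ Z *ᵥ y)) := by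
  simp only [rankOneQuotient, minner_smul_left, minner_sub_left, minner_add_left,
    minner_vecMulVec]

theorem tendsto_rankOneQuotient (ω : ℝ) (x : ι → ℝ) (y : κ → ℝ) (a : ι → ℝ) (b : κ → ℝ) :
    Tendsto (rankOneQuotient ω x y a b) (𝓝[>] 0) (𝓝 (ω • (vecMulVec a y + vecMulVec x b))) := by
  have hq : 0 ≤ (a ⬝ᵥ a + b ⬝ᵥ b) / 2 := by
    linarith [dotProduct_self_nonneg' a, dotProduct_self_nonneg' b]
  have hc : Continuous (rankOneQuotient ω x y a b) := by
    have : ∀ t : ℝ, 1 + t ^ 2 * ((a ⬝ᵥ a + b ⬝ᵥ b) / 2) ≠ 0 := fun t => by positivity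
    unfold rankOneQuotient
    fun_prop (disch := assumption)
  have := (hc.tendsto 0).mono_left (nhdsWithin_le_nhds (s := Ioi 0))
  simpa [rankOneQuotient] using this

variable [Nonempty κ]

theorem IsTopFactorization.isDualFeasible_curve (F : IsTopFactorization P W w u v) (i : τ)
    {a : ι → ℝ} {b : κ → ℝ} (hab : a ⬝ᵥ u i + b ⬝ᵥ v i = 0) (t : ℝ) :
    IsDualFeasible (W + t • rankOneQuotient (w i) (u i) (v i) a b t) := by
  intro Z
  rw [minner_add_left, minner_smul_left, minner_rankOneQuotient]
  set q := (a ⬝ᵥ a + b ⬝ᵥ b) / 2 with hq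
  have hq0 : 0 ≤ q := by
    linarith [dotProduct_self_nonneg' a, dotProduct_self_nonneg' b]
  have h1 : minner W Z - w i * (u i ⬝ᵥ Z *ᵥ v i) ≤ (1 - w i) * specNorm Z := by
    rw [F.minner_eq, ← F.sum_eq_one, ← Finset.sum_erase_eq_sub (Finset.mem_univ i),
      ← Finset.sum_erase_eq_sub (Finset.mem_univ i), Finset.sum_mul]
    exact Finset.sum_le_sum fun j _ => mul_le_mul_of_nonneg_left
      (dotProduct_mulVec_le_specNorm Z (F.left_self j) (F.right_self j)) (F.pos j).le
  have h2 := two_mul_dotProduct_mulVec_le Z (u i + t • a) (v i + t • b)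
  simp only [mulVec_add, mulVec_smul, add_dotProduct, dotProduct_add, smul_dotProduct,
    dotProduct_smul, smul_eq_mul, F.left_self, F.right_self, dotProduct_comm (u i) a,
    dotProduct_comm (v i) b] at h2
  have h3 : u i ⬝ᵥ Z *ᵥ v i + t * (a ⬝ᵥ Z *ᵥ v i + u i ⬝ᵥ Z *ᵥ b + t * (a ⬝ᵥ Z *ᵥ b)) ≤
      specNorm Z * (1 + t ^ 2 * q) := by
    linear_combination h2 / 2 + specNorm Z * t * hab - specNorm Z * t ^ 2 * hq
  have hpos : 0 < 1 + t ^ 2 * q := by positivity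
  have h4 : minner W Z + t * (w i * (1 + t ^ 2 * q)⁻¹ *
      (a ⬝ᵥ Z *ᵥ v i + u i ⬝ᵥ Z *ᵥ b + t * (a ⬝ᵥ Z *ᵥ b) - t * q * (u i ⬝ᵥ Z *ᵥ v i))) =
      minner W Z - w i * (u i ⬝ᵥ Z *ᵥ v i) + w i * ((u i ⬝ᵥ Z *ᵥ v i +
        t * (a ⬝ᵥ Z *ᵥ v i + u i ⬝ᵥ Z *ᵥ b + t * (a ⬝ᵥ Z *ᵥ b))) / (1 + t ^ 2 * q)) := by
    field_simp
    ring
  rw [h4]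
  have h5 := mul_le_mul_of_nonneg_left ((div_le_iff₀ hpos).2 h3) (F.pos i).le
  linarith

theorem IsTopFactorization.tangent_mem_critThetaStar (F : IsTopFactorization P W w u v)
    (hW : IsDualFeasible W) (i : τ) {a : ι → ℝ} {b : κ → ℝ} (hab : a ⬝ᵥ u i + b ⬝ᵥ v i = 0) :
    w i • (vecMulVec a (v i) + vecMulVec (u i) b) ∈ critThetaStar W P := by
  refine mem_critThetaStar_of_tendsto hW ?_ _ (tendsto_rankOneQuotient (w i) (u i) (v i) a b)
    (Eventually.of_forall fun t => F.isDualFeasible_curve i hab t)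
  rw [minner_smul_left, minner_add_left, minner_vecMulVec, minner_vecMulVec,
    F.tangent_eq_zero i hab, mul_zero]

theorem sub_mem_critThetaStar (hW : IsDualFeasible W) (hWP : minner W P = specNorm P)
    {x : ι → ℝ} {y : κ → ℝ} (hxy : IsTopPair P x y) :
    vecMulVec x y - ((x ⬝ᵥ x + y ⬝ᵥ y) / 2) • W ∈ critThetaStar W P := by
  have hxy' : 2 * (x ⬝ᵥ P *ᵥ y) = specNorm P * (x ⬝ᵥ x + y ⬝ᵥ y) := hxy
  set q := (x ⬝ᵥ x + y ⬝ᵥ y) / 2 with hq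
  refine mem_critThetaStar_of_tendsto hW ?_ _ tendsto_const_nhds ?_
  · rw [minner_sub_left, minner_smul_left, minner_vecMulVec, hWP]
    linear_combination hxy' / 2 - specNorm P * hq
  · have h1 : ∀ᶠ t : ℝ in 𝓝[>] 0, t * q < 1 :=
      nhdsWithin_le_nhds ((by fun_prop : Continuous fun t : ℝ => t * q).tendsto 0 |>.eventually
        (gt_mem_nhds (by simp)))
    filter_upwards [h1, self_mem_nhdsWithin] with t ht (ht0 : 0 < t)
    intro Z
    have h2 := two_mul_dotProduct_mulVec_le Z x y
    have h3 : t * (x ⬝ᵥ Z *ᵥ y) ≤ t * (specNorm Z * q) :=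
      mul_le_mul_of_nonneg_left (by rw [hq]; linarith) ht0.le
    have h4 := mul_le_mul_of_nonneg_left (hW Z) (sub_nonneg.2 ht.le)
    rw [minner_add_left, minner_smul_left, minner_sub_left, minner_smul_left, minner_vecMulVec]
    linarith

theorem IsTopFactorization.isNullDirection_of_mem_polarCone (F : IsTopFactorization P W w u v)
    (hP : 0 < specNorm P) (hW : IsDualFeasible W) (hWP : minner W P = specNorm P)
    (hH : H ∈ polarCone (critThetaStar W P)) :
    IsNullDirection P (H - (minner W H / specNorm P) • P) u v := by
  set K := H - (minner W H / specNorm P) • P with hK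
  have hKW : minner W K = 0 := by
    rw [hK, minner_sub_right, minner_smul_right, hWP]
    field_simp
    ring
  have hpol : ∀ D ∈ critThetaStar W P, minner D K ≤ 0 := by
    intro D hD
    rw [hK, minner_sub_right, minner_smul_right, minner_eq_zero_of_mem_critThetaStar hW hD,
      minner_comm]
    linarith [hH D hD]
  refine F.isNullDirection hKW (fun x y hxy => ?_) fun i a b hab => ?_
  · have := hpol _ (sub_mem_critThetaStar hW hWP hxy)
    rw [minner_sub_left, minner_smul_left, minner_vecMulVec, hKW] at this
    linarith
  · have := hpol _ (F.tangent_mem_critThetaStar hW i hab)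
    rw [minner_smul_left, minner_add_left, minner_vecMulVec, minner_vecMulVec] at this
    exact nonpos_of_mul_nonpos_right this (F.pos i)

theorem IsTopFactorization.le_dirDeriv2 (F : IsTopFactorization P W w u v)
    (hWP : minner W P = specNorm P) (hH : dirDeriv specNorm P H = minner W H) (i : τ)
    {a : ι → ℝ} {b : κ → ℝ} (hab : a ⬝ᵥ u i + b ⬝ᵥ v i = 0) (Z : Matrix ι κ ℝ) :
    minner W Z + 2 * w i * (a ⬝ᵥ P *ᵥ b - (a ⬝ᵥ a + b ⬝ᵥ b) / 2 * specNorm P +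
      (a ⬝ᵥ H *ᵥ v i + u i ⬝ᵥ H *ᵥ b)) ≤ dirDeriv2 specNorm P H Z := by
  set d := rankOneQuotient (w i) (u i) (v i) a b with hd
  set q := (a ⬝ᵥ a + b ⬝ᵥ b) / 2 with hq
  have hq0 : 0 ≤ q := by
    linarith [dotProduct_self_nonneg' a, dotProduct_self_nonneg' b]
  have hlim : Tendsto (fun t : ℝ => minner W Z + 2 * w i * (1 + t ^ 2 * q)⁻¹ *
      (a ⬝ᵥ P *ᵥ b - q * specNorm P) + 2 * minner H (d t) + t * minner Z (d t)) (𝓝[>] 0)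
      (𝓝 (minner W Z + 2 * w i * (1 + 0 ^ 2 * q)⁻¹ * (a ⬝ᵥ P *ᵥ b - q * specNorm P) +
        2 * minner H (w i • (vecMulVec a (v i) + vecMulVec (u i) b)) +
        0 * minner Z (w i • (vecMulVec a (v i) + vecMulVec (u i) b)))) := by
    have ht : Tendsto (fun t : ℝ => t) (𝓝[>] 0) (𝓝 0) := nhdsWithin_le_nhds
    have hdt := tendsto_rankOneQuotient (w i) (u i) (v i) a b
    have hin : ∀ M : Matrix ι κ ℝ, Tendsto (fun t => minner M (d t)) (𝓝[>] 0)
        (𝓝 (minner M (w i • (vecMulVec a (v i) + vecMulVec (u i) b)))) := fun M =>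
      ((continuous_minner_left M).tendsto _).comp hdt
    have hc : Tendsto (fun t : ℝ => (1 + t ^ 2 * q)⁻¹) (𝓝[>] 0) (𝓝 (1 + 0 ^ 2 * q)⁻¹) :=
      (((ht.pow 2).mul_const q).const_add 1).inv₀ (by positivity)
    exact (((hc.const_mul _).mul_const _).const_add _ |>.add ((hin H).const_mul 2)).add
      (ht.mul (hin Z))
  have hmain : ∀ᶠ t : ℝ in 𝓝[>] 0, minner W Z + 2 * w i * (1 + t ^ 2 * q)⁻¹ *
      (a ⬝ᵥ P *ᵥ b - q * specNorm P) + 2 * minner H (d t) + t * minner Z (d t) ≤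
      (specNorm (P + t • H + (t ^ 2 / 2) • Z) - specNorm P - t * dirDeriv specNorm P H) /
        (t ^ 2 / 2) := by
    filter_upwards [self_mem_nhdsWithin] with t (ht0 : 0 < t)
    have h1 := F.isDualFeasible_curve i hab t (P + t • H + (t ^ 2 / 2) • Z)
    have h2 : minner (d t) P =
        w i * (1 + t ^ 2 * q)⁻¹ * (t * (a ⬝ᵥ P *ᵥ b - q * specNorm P)) := by
      rw [hd, minner_rankOneQuotient, F.tangent_eq_zero i hab, F.dotProduct_mulVec]
      ring
    rw [← hd] at h1
    simp only [minner_add_left, minner_smul_left, minner_add_right, minner_smul_right, h2, hWP]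
      at h1
    rw [le_div_iff₀ (by positivity), hH, minner_comm H, minner_comm Z]
    linarith
  refine le_trans (le_of_eq ?_) (le_of_tendsto_of_tendsto hlim
    (tendsto_dirDeriv2_specNorm P H Z) hmain)
  rw [minner_comm H, minner_smul_left, minner_add_left, minner_vecMulVec, minner_vecMulVec]
  simp
  ring

theorem le_zero_of_forall_pos_mul_sq {p q : ℝ} (h : ∀ δ > 0, δ ^ 2 * q + δ * p ≤ 0) : p ≤ 0 := by
  have hlim : Tendsto (fun δ : ℝ => δ * q + p) (𝓝[>] 0) (𝓝 (0 * q + p)) :=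
    ((by fun_prop : Continuous fun δ : ℝ => δ * q + p).tendsto 0).mono_left nhdsWithin_le_nhds
  have := le_of_tendsto (b := 0) hlim (by
    filter_upwards [self_mem_nhdsWithin] with δ (hδ : 0 < δ)
    refine nonpos_of_mul_nonpos_right ?_ hδ
    linarith [h δ hδ])
  linarith

theorem IsTopFactorization.isNullDirection_of_sigmaTheta (F : IsTopFactorization P W w u v)
    (hP : 0 < specNorm P) (hWP : minner W P = specNorm P)
    (hH : dirDeriv specNorm P H = minner W H) (hσ : sigmaTheta P H W = 0) :
    IsNullDirection P (H - (minner W H / specNorm P) • P) u v := by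
  set μ := minner W H / specNorm P with hμ
  have hμP : μ * specNorm P = minner W H := by rw [hμ]; field_simp
  refine F.isNullDirection ?_ (fun x y hxy => ?_) fun i a b hab => ?_
  · rw [minner_sub_right, minner_smul_right, hWP, hμP, sub_self]
  · obtain ⟨f, hf, hf'⟩ := exists_max_on_topPair P H
    have h1 := hf x y hxy
    rw [← tendsto_dirDeriv_specNorm P H f hf hf', hH, ← hμP] at h1
    have hxy' : 2 * (x ⬝ᵥ P *ᵥ y) = specNorm P * (x ⬝ᵥ x + y ⬝ᵥ y) := hxy
    rw [sub_mulVec, smul_mulVec, dotProduct_sub, dotProduct_smul, smul_eq_mul]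
    linear_combination h1 / 2 - μ / 2 * hxy'
  · have hH' : a ⬝ᵥ H *ᵥ v i + u i ⬝ᵥ H *ᵥ b ≤ 0 := by
      refine le_zero_of_forall_pos_mul_sq
        (q := a ⬝ᵥ P *ᵥ b - (a ⬝ᵥ a + b ⬝ᵥ b) / 2 * specNorm P) fun δ _ => ?_
      have hab' : (δ • a) ⬝ᵥ u i + (δ • b) ⬝ᵥ v i = 0 := by
        rw [smul_dotProduct, smul_dotProduct, ← smul_add, hab, smul_zero]
      have h1 := F.le_dirDeriv2 hWP hH i hab'
      simp only [mulVec_smul, smul_dotProduct, dotProduct_smul, smul_eq_mul] at h1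
      have h2 : sigmaTheta P H W ≤ ((-(2 * w i * (δ ^ 2 * (a ⬝ᵥ P *ᵥ b -
          (a ⬝ᵥ a + b ⬝ᵥ b) / 2 * specNorm P) + δ * (a ⬝ᵥ H *ᵥ v i + u i ⬝ᵥ H *ᵥ b))) : ℝ) :
          EReal) := by
        refine iSup_le fun Z => ?_
        norm_cast
        linarith [h1 Z]
      rw [hσ] at h2
      norm_cast at h2
      exact nonpos_of_mul_nonpos_right (by linarith) (F.pos i)
    have hPt := F.tangent_eq_zero i hab
    simp only [sub_mulVec, smul_mulVec, dotProduct_sub, dotProduct_smul, smul_eq_mul]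
    linear_combination hH' - μ * hPt

end NullDirections

section SecondOrderCorrection

open Topology

variable {ι κ τ : Type*} [Fintype ι] [Fintype κ] [Fintype τ] [DecidableEq τ]
  {P W K : Matrix ι κ ℝ} {w : τ → ℝ} {u : τ → ι → ℝ} {v : τ → κ → ℝ}

theorem IsTopFactorization.nonempty (F : IsTopFactorization P W w u v) : Nonempty τ := by
  by_contra h
  rw [not_nonempty_iff] at h
  simpa using F.sum_eq_one

theorem IsTopFactorization.minner_eq_zero (F : IsTopFactorization P W w u v) {Z : Matrix ι κ ℝ}
    (hZ : ∀ i, Z *ᵥ v i = 0) : minner W Z = 0 := by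
  simp [F.minner_eq, hZ]

variable [Nonempty κ]

theorem specNorm_le_of_split (hu : ∀ i j, u i ⬝ᵥ u j = if i = j then 1 else 0)
    (hv : ∀ i j, v i ⬝ᵥ v j = if i = j then 1 else 0) {M B : Matrix ι κ ℝ} {r : ℝ} (hr : 0 ≤ r)
    (hM : ∀ i, M *ᵥ v i = r • u i) (hB : specNorm B ≤ r)
    (hMB : ∀ z, (∀ i, v i ⬝ᵥ z = 0) → M *ᵥ z = B *ᵥ z)
    (huB : ∀ z, (∀ i, v i ⬝ᵥ z = 0) → ∀ i, u i ⬝ᵥ B *ᵥ z = 0) : specNorm M ≤ r := by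
  refine specNorm_le_of_forall _ hr fun x => ?_
  set c : τ → ℝ := fun i => v i ⬝ᵥ x with hc
  set y := ∑ i, c i • v i with hy
  obtain ⟨z, hx⟩ : ∃ z, x = y + z := ⟨x - y, by simp⟩
  have hvz : ∀ i, v i ⬝ᵥ z = 0 := by
    intro i
    have h1 : v i ⬝ᵥ y = c i := by simp [hy, dotProduct_sum, hv]
    have h2 : c i = v i ⬝ᵥ y + v i ⬝ᵥ z := by rw [← dotProduct_add, ← hx]
    linarith
  have hyz : y ⬝ᵥ z = 0 := by simp [hy, sum_dotProduct, hvz]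
  have hMy : M *ᵥ y = r • ∑ i, c i • u i := by
    simp only [hy, mulVec_sum, mulVec_smul, hM, Finset.smul_sum, smul_comm r]
  have horth : (∑ i, c i • u i) ⬝ᵥ (B *ᵥ z) = 0 := by
    simp [sum_dotProduct, huB z hvz]
  have hyy : y ⬝ᵥ y = ∑ i, c i ^ 2 := sum_smul_dotProduct_self hv c
  have hBz : (B *ᵥ z) ⬝ᵥ (B *ᵥ z) ≤ r ^ 2 * (z ⬝ᵥ z) :=
    (mulVec_dotProduct_self_le B z).trans (mul_le_mul_of_nonneg_right
      (pow_le_pow_left₀ (specNorm_nonneg B) hB 2) (dotProduct_self_nonneg' z))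
  simp only [hx, mulVec_add, hMB z hvz, hMy, add_dotProduct, dotProduct_add, smul_dotProduct,
    dotProduct_smul, smul_eq_mul, sum_smul_dotProduct_self hu, dotProduct_comm (B *ᵥ z), horth,
    dotProduct_comm z y, hyz, hyy]
  linarith

theorem IsTopFactorization.dirDeriv_add_smul (F : IsTopFactorization P W w u v)
    (N : IsNullDirection P K u v) (μ : ℝ) :
    dirDeriv specNorm P (K + μ • P) = μ * specNorm P := by
  obtain ⟨f, hf, hf'⟩ := exists_max_on_topPair P (K + μ • P)
  rw [tendsto_dirDeriv_specNorm P _ f hf hf']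
  obtain ⟨i⟩ := F.nonempty
  have h1 := hf _ _ (F.isTopPair i)
  simp only [add_mulVec, smul_mulVec, N.mulVec_eq, zero_add, dotProduct_smul, smul_eq_mul,
    F.dotProduct_mulVec, F.left_self, F.right_self] at h1
  obtain ⟨x, y, h2, h3, h4⟩ := hf'
  have h5 := N.nonpos x y h3
  rw [IsTopPair, h2] at h3
  simp only [add_mulVec, smul_mulVec, dotProduct_add, dotProduct_smul, smul_eq_mul] at h4
  refine le_antisymm ?_ (by linarith)
  linear_combination 2 * h5 - h4 + μ * h3

theorem IsTopFactorization.exists_quadratic_bound (F : IsTopFactorization P W w u v)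
    (N : IsNullDirection P K u v) :
    ∃ C > 0, ∀ᶠ t : ℝ in 𝓝[>] 0, specNorm (P + t • K) ≤ specNorm P + C * t ^ 2 := by
  have hd : dirDeriv specNorm P K = 0 := by simpa using F.dirDeriv_add_smul N 0
  have h := tendsto_dirDeriv2_specNorm P K 0
  simp only [hd, mul_zero, sub_zero, smul_zero, add_zero] at h
  set L := dirDeriv2 specNorm P K 0
  refine ⟨(|L| + 1) / 2, by positivity, ?_⟩
  filter_upwards [h.eventually (gt_mem_nhds (lt_of_le_of_lt (le_abs_self L) (lt_add_one |L|))),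
    self_mem_nhdsWithin] with t ht (ht0 : 0 < t)
  rw [div_lt_iff₀ (by positivity)] at ht
  linarith

/-- A second-order correction along which the spectral norm grows only affinely. -/
theorem IsTopFactorization.exists_correction (F : IsTopFactorization P W w u v)
    (hP : 0 < specNorm P) (N : IsNullDirection P K u v) :
    ∃ Z : Matrix ι κ ℝ, (∀ i, Z *ᵥ v i = 0) ∧ ∀ μ : ℝ, ∀ᶠ t : ℝ in 𝓝[>] 0,
      specNorm ((1 + t * μ) • P + t • K + t ^ 2 • Z) ≤ (1 + t * μ) * specNorm P := by
  obtain ⟨C, hC, hbound⟩ := F.exists_quadratic_bound N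
  set c := 2 * C / specNorm P with hc
  have hcP : c * specNorm P = 2 * C := by rw [hc]; field_simp
  set Q := ∑ i, vecMulVec (v i) (v i) with hQ
  have hQv : ∀ i, Q *ᵥ v i = v i := fun i => by
    simp [hQ, sum_vecMulVec_mulVec, F.right_orth]
  have hQz : ∀ z, (∀ i, v i ⬝ᵥ z = 0) → Q *ᵥ z = 0 := fun z hz => by
    simp [hQ, sum_vecMulVec_mulVec, hz]
  refine ⟨-c • (P - P * Q), fun i => ?_, fun μ => ?_⟩
  · rw [smul_mulVec, sub_mulVec, ← mulVec_mulVec, hQv, sub_self, smul_zero]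
  set β : ℝ → ℝ := fun t => 1 + t * μ - c * t ^ 2 with hβ
  have hβc : Continuous β := by fun_prop
  have hβ1 : Tendsto β (𝓝[>] 0) (𝓝 1) := by
    have := (hβc.tendsto 0).mono_left (nhdsWithin_le_nhds (s := Ioi 0))
    simpa [hβ] using this
  have hβhalf : ∀ᶠ t in 𝓝[>] 0, 1 / 2 < β t := hβ1.eventually (lt_mem_nhds (by norm_num))
  have hs : Tendsto (fun t => t / β t) (𝓝[>] 0) (𝓝[>] 0) := by
    refine tendsto_nhdsWithin_iff.2 ⟨?_, ?_⟩
    · have ht : Tendsto (fun t : ℝ => t) (𝓝[>] 0) (𝓝 0) := nhdsWithin_le_nhds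
      have := ht.div hβ1 one_ne_zero
      rwa [zero_div] at this
    · filter_upwards [hβhalf, self_mem_nhdsWithin] with t h1 (h2 : 0 < t)
      exact div_pos h2 (by linarith)
  filter_upwards [hβhalf, hs.eventually hbound, self_mem_nhdsWithin] with t h1 h2 (ht : 0 < t)
  have hβ0 : 0 < β t := by linarith
  have hβt : β t = 1 + t * μ - c * t ^ 2 := rfl
  have hB : specNorm (β t • P + t • K) ≤ (1 + t * μ) * specNorm P := by
    have h3 : β t • P + t • K = β t • (P + (t / β t) • K) := by
      rw [smul_add, smul_smul, mul_div_cancel₀ _ hβ0.ne']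
    rw [h3]
    refine (specNorm_smul_le hβ0.le _).trans
      ((mul_le_mul_of_nonneg_left h2 hβ0.le).trans ?_)
    have h4 : β t * (specNorm P + C * (t / β t) ^ 2) = β t * specNorm P + C * t ^ 2 / β t := by
      field_simp
    have h5 : C * t ^ 2 / β t ≤ 2 * C * t ^ 2 := by
      rw [div_le_iff₀ hβ0]
      nlinarith [mul_pos hC (pow_pos ht 2)]
    rw [h4, hβt]
    linear_combination h5 - t ^ 2 * hcP
  refine specNorm_le_of_split F.left_orth F.right_orth ((specNorm_nonneg _).trans hB)
    (fun i => ?_) hB (fun z hz => ?_) fun z hz i => ?_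
  · simp only [add_mulVec, smul_mulVec, sub_mulVec, ← mulVec_mulVec, hQv, N.mulVec_eq,
      F.mulVec_eq, sub_self, smul_zero, add_zero, smul_smul]
  · simp only [add_mulVec, smul_mulVec, sub_mulVec, ← mulVec_mulVec, hQz z hz, mulVec_zero,
      sub_zero, hβt]
    module
  · rw [add_mulVec, smul_mulVec, smul_mulVec, dotProduct_add, dotProduct_smul, dotProduct_smul,
      dotProduct_mulVec_eq_transpose, dotProduct_mulVec_eq_transpose, F.transpose_mulVec_eq,
      N.transpose_mulVec_eq, smul_dotProduct, hz]
    simp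

theorem IsTopFactorization.mem_critTheta (F : IsTopFactorization P W w u v)
    (hWP : minner W P = specNorm P) (N : IsNullDirection P K u v) (μ : ℝ) :
    K + μ • P ∈ critTheta P W := by
  change dirDeriv specNorm P (K + μ • P) = minner (K + μ • P) W
  rw [F.dirDeriv_add_smul N, minner_comm, minner_add_right, minner_smul_right, hWP,
    F.minner_eq_zero N.mulVec_eq, zero_add]

theorem IsTopFactorization.sigmaTheta_eq_zero (F : IsTopFactorization P W w u v)
    (hP : 0 < specNorm P) (hWP : minner W P = specNorm P) (N : IsNullDirection P K u v) (μ : ℝ) :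
    sigmaTheta P (K + μ • P) W = 0 := by
  have hcrit : dirDeriv specNorm P (K + μ • P) = minner W (K + μ • P) :=
    (F.mem_critTheta hWP N μ : _ = _).trans (minner_comm _ _)
  refine le_antisymm (iSup_le fun Z => ?_) ?_
  · obtain ⟨i⟩ := F.nonempty
    have := F.le_dirDeriv2 hWP hcrit i (a := 0) (b := 0) (by simp) Z
    simp at this
    exact_mod_cast sub_nonpos.2 this
  · obtain ⟨Z, hZ, hbound⟩ := F.exists_correction hP N
    refine le_iSup_of_le ((2 : ℝ) • Z) ?_
    have h1 : dirDeriv2 specNorm P (K + μ • P) ((2 : ℝ) • Z) ≤ 0 := by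
      refine le_of_tendsto (tendsto_dirDeriv2_specNorm P (K + μ • P) ((2 : ℝ) • Z)) ?_
      filter_upwards [hbound μ] with t ht
      refine div_nonpos_of_nonpos_of_nonneg ?_ (by positivity)
      have h2 : P + t • (K + μ • P) + (t ^ 2 / 2) • (2 : ℝ) • Z =
          (1 + t * μ) • P + t • K + t ^ 2 • Z := by module
      rw [h2, F.dirDeriv_add_smul N]
      linarith
    rw [minner_smul_right, F.minner_eq_zero hZ, mul_zero, zero_sub]
    exact_mod_cast neg_nonneg.2 h1

theorem IsTopFactorization.mem_polarCone (F : IsTopFactorization P W w u v)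
    (hP : 0 < specNorm P) (hW : IsDualFeasible W) (hWP : minner W P = specNorm P)
    (N : IsNullDirection P K u v) (μ : ℝ) :
    K + μ • P ∈ polarCone (critThetaStar W P) := by
  intro D hD
  obtain ⟨Z, hZ, hbound⟩ := F.exists_correction hP N
  have hDP : minner P D = 0 :=
    (minner_comm _ _).trans (minner_eq_zero_of_mem_critThetaStar hW hD)
  rw [minner_add_left, minner_smul_left, hDP, mul_zero, add_zero]
  have hlim : Tendsto (fun t : ℝ => minner K D + t * minner Z D) (𝓝[>] 0)
      (𝓝 (minner K D + 0 * minner Z D)) :=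
    ((by fun_prop : Continuous fun t : ℝ => minner K D + t * minner Z D).tendsto 0).mono_left
      nhdsWithin_le_nhds
  rw [zero_mul, add_zero] at hlim
  refine le_of_tendsto hlim ?_
  filter_upwards [hbound 0, self_mem_nhdsWithin] with t ht (ht0 : 0 < t)
  rw [mul_zero, add_zero, one_smul, one_mul] at ht
  have h1 := minner_nonpos_of_mem_critThetaStar hW hD (Y := P + t • K + t ^ 2 • Z) (by
    rwa [minner_add_right, minner_add_right, minner_smul_right, minner_smul_right, hWP,
      F.minner_eq_zero N.mulVec_eq, F.minner_eq_zero hZ, mul_zero, mul_zero, add_zero, add_zero])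
  rw [minner_add_left, minner_add_left, minner_smul_left, minner_smul_left, hDP] at h1
  refine nonpos_of_mul_nonpos_right ?_ ht0
  linarith

end SecondOrderCorrection

/-- Proposition 3.2 (ii): `H ∈ C_θ(P,W)` together with
`ψ*_{(P,H)}(W) = 0` holds if and only if `H` lies in the polar of `C_{θ*}(W,P)`. -/
theorem critTheta_sigma_zero_iff_mem_polar_critThetaStar {m n : ℕ} (hmn : m ≤ n)
    (P W : Matrix (Fin m) (Fin n) ℝ) (hP : P ≠ 0)
    (hW : W ∈ subdiff specNorm P)
    (H : Matrix (Fin m) (Fin n) ℝ) :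
    (H ∈ critTheta P W ∧ sigmaTheta P H W = 0) ↔
      H ∈ polarCone (critThetaStar W P) := by
  have : Nonempty (Fin n) := by
    by_contra h
    rw [not_nonempty_iff] at h
    exact hP (Subsingleton.elim _ _)
  have hσ := specNorm_pos hP
  have hWd := isDualFeasible_of_mem_subdiff hW
  have hWP := minner_eq_specNorm_of_mem_subdiff hW
  obtain ⟨τ, _, _, w, u, v, F⟩ := exists_isTopFactorization hσ hWd hWP
  set μ := minner W H / specNorm P with hμ
  have hH : H = (H - μ • P) + μ • P := (sub_add_cancel _ _).symm
  constructor
  · rintro ⟨hcrit, hsig⟩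
    rw [hH]
    exact F.mem_polarCone hσ hWd hWP (F.isNullDirection_of_sigmaTheta hσ hWP
      ((hcrit : _ = _).trans (minner_comm _ _)) hsig) μ
  · intro hpol
    have N := F.isNullDirection_of_mem_polarCone hσ hWd hWP hpol
    rw [hH]
    exact ⟨F.mem_critTheta hWP N μ, F.sigmaTheta_eq_zero hσ hWP N μ⟩
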